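/- arXiv:2507.19719 — 7 statements merged into one kernel-verified Lean document; each statement's English description precedes it below -/
import Mathlib

section
/- Let k be a field and let p, q ∈ k be nonzero with r ∈ k satisfying r·(p³ − q³) = 0. Then each of the three assignments ν_x(x) = −x, ν_x(y) = −pq⁻¹y, ν_x(z) = −p⁻¹qz; ν_y(x) = −p⁻¹qx, ν_y(y) = −y, ν_y(z) = −pq⁻¹z; ν_z(x) = −pq⁻¹x, ν_z(y) = −p⁻¹qy, ν_z(z) = −z extends (uniquely) to a k-algebra automorphism of S(p,q,r). -/
noncomputable section

variable (k : Type*) [Field k]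

/-- The generators `x = g3 0`, `y = g3 1`, `z = g3 2` of the free algebra `k⟨x,y,z⟩`. -/
def g3 (i : Fin 3) : FreeAlgebra k (Fin 3) := FreeAlgebra.ι k i

/-- The relation whose induced ring quotient is the quotient of `k⟨x,y,z⟩` by the two-sided
ideal generated by `p·yz + q·zy + r·x²`, `p·zx + q·xz + r·y²` and `p·xy + q·yx + r·z²`. -/
def sklyRel (p q r : k) : FreeAlgebra k (Fin 3) → FreeAlgebra k (Fin 3) → Prop := fun a b =>
  b = 0 ∧
    (a = algebraMap k _ p * (g3 k 1 * g3 k 2) + algebraMap k _ q * (g3 k 2 * g3 k 1)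
          + algebraMap k _ r * (g3 k 0 * g3 k 0) ∨
     a = algebraMap k _ p * (g3 k 2 * g3 k 0) + algebraMap k _ q * (g3 k 0 * g3 k 2)
          + algebraMap k _ r * (g3 k 1 * g3 k 1) ∨
     a = algebraMap k _ p * (g3 k 0 * g3 k 1) + algebraMap k _ q * (g3 k 1 * g3 k 0)
          + algebraMap k _ r * (g3 k 2 * g3 k 2))

/-- The three-dimensional Sklyanin algebra `S(p,q,r)`. -/
abbrev Skly3 (p q r : k) : Type _ := RingQuot (sklyRel k p q r)

/-- The images of the generators `x, y, z` in `S(p,q,r)`. -/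
def sgen (p q r : k) (i : Fin 3) : Skly3 k p q r :=
  RingQuot.mkAlgHom k (sklyRel k p q r) (g3 k i)

variable {k} in
/-- The relations of `S(p,q,r)` scale by a common factor under `x_i ↦ c i • x_i`. -/
def IsSklyScaling (r : k) (c : Fin 3 → k) : Prop :=
  r * (c 0 * c 0) = r * (c 1 * c 2) ∧ r * (c 1 * c 1) = r * (c 2 * c 0) ∧
    r * (c 2 * c 2) = r * (c 0 * c 1)

theorem sgen_relations (p q r : k) :
    (p • (sgen k p q r 1 * sgen k p q r 2) + q • (sgen k p q r 2 * sgen k p q r 1)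
      + r • (sgen k p q r 0 * sgen k p q r 0) = 0) ∧
    (p • (sgen k p q r 2 * sgen k p q r 0) + q • (sgen k p q r 0 * sgen k p q r 2)
      + r • (sgen k p q r 1 * sgen k p q r 1) = 0) ∧
    (p • (sgen k p q r 0 * sgen k p q r 1) + q • (sgen k p q r 1 * sgen k p q r 0)
      + r • (sgen k p q r 2 * sgen k p q r 2) = 0) := by
  refine ⟨?_, ?_, ?_⟩
  · simpa [sgen, Algebra.smul_def] using
      RingQuot.mkAlgHom_rel k (s := sklyRel k p q r) ⟨rfl, Or.inl rfl⟩
  · simpa [sgen, Algebra.smul_def] using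
      RingQuot.mkAlgHom_rel k (s := sklyRel k p q r) ⟨rfl, Or.inr (Or.inl rfl)⟩
  · simpa [sgen, Algebra.smul_def] using
      RingQuot.mkAlgHom_rel k (s := sklyRel k p q r) ⟨rfl, Or.inr (Or.inr rfl)⟩

variable {k}

theorem skly3_algHom_ext {p q r : k} {A : Type*} [Semiring A] [Algebra k A]
    {f g : Skly3 k p q r →ₐ[k] A} (h : ∀ i, f (sgen k p q r i) = g (sgen k p q r i)) : f = g :=
  RingQuot.ringQuot_ext' k f g (FreeAlgebra.hom_ext (funext h))

theorem smul_relation_eq_zero {A : Type*} [Ring A] [Algebra k A] {p q r a b c : k} {u v w : A}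
    (h : p • (v * w) + q • (w * v) + r • (u * u) = 0) (hr : r * (a * a) = r * (b * c)) :
    p • ((b • v) * (c • w)) + q • ((c • w) * (b • v)) + r • ((a • u) * (a • u)) = 0 := by
  have key : p • ((b • v) * (c • w)) + q • ((c • w) * (b • v)) + r • ((a • u) * (a • u))
      = (b * c) • (p • (v * w) + q • (w * v) + r • (u * u)) := by
    simp only [smul_mul_smul_comm, smul_add, smul_smul, hr]
    rw [mul_comm p, mul_comm q, mul_comm r, mul_comm c b]
  rw [key, h, smul_zero]

theorem exists_skly3_algHom {p q r : k} {c : Fin 3 → k} (hc : IsSklyScaling r c) :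
    ∃ f : Skly3 k p q r →ₐ[k] Skly3 k p q r, ∀ i, f (sgen k p q r i) = c i • sgen k p q r i := by
  obtain ⟨h0, h1, h2⟩ := sgen_relations k p q r
  obtain ⟨c0, c1, c2⟩ := hc
  refine ⟨RingQuot.liftAlgHom k
    ⟨FreeAlgebra.lift k fun i => c i • sgen k p q r i, ?_⟩, fun i => ?_⟩
  · rintro a b ⟨rfl, rfl | rfl | rfl⟩ <;>
      simp only [g3, map_add, map_mul, map_zero, map_smul, FreeAlgebra.lift_ι_apply,
        ← Algebra.smul_def]
    · exact smul_relation_eq_zero h0 c0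
    · exact smul_relation_eq_zero h1 c1
    · exact smul_relation_eq_zero h2 c2
  · simp only [sgen, g3, RingQuot.liftAlgHom_mkAlgHom_apply, FreeAlgebra.lift_ι_apply]

theorem IsSklyScaling.inv {r : k} {c : Fin 3 → k} (hc : IsSklyScaling r c) :
    IsSklyScaling r fun i => (c i)⁻¹ := by
  rcases eq_or_ne r 0 with rfl | hr
  · simp [IsSklyScaling]
  · simpa only [IsSklyScaling, mul_right_inj' hr, ← mul_inv, inv_inj] using hc

theorem existsUnique_skly3_algEquiv {p q r : k} {c : Fin 3 → k} (hc : IsSklyScaling r c)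
    (h0 : ∀ i, c i ≠ 0) :
    ∃! ν : Skly3 k p q r ≃ₐ[k] Skly3 k p q r,
      ∀ i, ν (sgen k p q r i) = c i • sgen k p q r i := by
  obtain ⟨f, hf⟩ := exists_skly3_algHom (p := p) (q := q) hc
  obtain ⟨g, hg⟩ := exists_skly3_algHom (p := p) (q := q) hc.inv
  refine ⟨AlgEquiv.ofAlgHom f g (skly3_algHom_ext fun i => ?_) (skly3_algHom_ext fun i => ?_),
    hf, fun ν hν => ?_⟩
  · simp [hf, hg, smul_smul, h0 i]
  · simp [hf, hg, smul_smul, h0 i]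
  · refine AlgEquiv.coe_toAlgHom_injective (skly3_algHom_ext fun i => ?_)
    exact (hν i).trans (hf i).symm

variable (k)

/-- Each of the assignments `νx, νy, νz` extends uniquely to a `k`-algebra automorphism of the
three-dimensional Sklyanin algebra `S(p,q,r)`. -/
theorem sklyanin3_nu_automorphisms (p q r : k) (hp : p ≠ 0) (hq : q ≠ 0)
    (hr : r * (p ^ 3 - q ^ 3) = 0) :
    (∃! νx : Skly3 k p q r ≃ₐ[k] Skly3 k p q r,
        νx (sgen k p q r 0) = -sgen k p q r 0 ∧
        νx (sgen k p q r 1) = (-(p * q⁻¹)) • sgen k p q r 1 ∧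
        νx (sgen k p q r 2) = (-(p⁻¹ * q)) • sgen k p q r 2) ∧
    (∃! νy : Skly3 k p q r ≃ₐ[k] Skly3 k p q r,
        νy (sgen k p q r 0) = (-(p⁻¹ * q)) • sgen k p q r 0 ∧
        νy (sgen k p q r 1) = -sgen k p q r 1 ∧
        νy (sgen k p q r 2) = (-(p * q⁻¹)) • sgen k p q r 2) ∧
    (∃! νz : Skly3 k p q r ≃ₐ[k] Skly3 k p q r,
        νz (sgen k p q r 0) = (-(p * q⁻¹)) • sgen k p q r 0 ∧
        νz (sgen k p q r 1) = (-(p⁻¹ * q)) • sgen k p q r 1 ∧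
        νz (sgen k p q r 2) = -sgen k p q r 2) := by
  have hpq : r = 0 ∨ p ^ 3 = q ^ 3 := (mul_eq_zero.mp hr).imp_right sub_eq_zero.mp
  have scaling : ∀ a b c : k, (r = 0 ∨ a * a = b * c ∧ b * b = c * a ∧ c * c = a * b) →
      IsSklyScaling r ![a, b, c] := by
    rintro a b c (rfl | ⟨h0, h1, h2⟩)
    · simp [IsSklyScaling]
    · simp [IsSklyScaling, h0, h1, h2]
  have main : ∀ a b c : k, a ≠ 0 → b ≠ 0 → c ≠ 0 →
      (r = 0 ∨ a * a = b * c ∧ b * b = c * a ∧ c * c = a * b) →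
      ∃! ν : Skly3 k p q r ≃ₐ[k] Skly3 k p q r, ν (sgen k p q r 0) = a • sgen k p q r 0 ∧
        ν (sgen k p q r 1) = b • sgen k p q r 1 ∧ ν (sgen k p q r 2) = c • sgen k p q r 2 := by
    intro a b c ha hb hc h
    simpa [Fin.forall_fin_succ] using existsUnique_skly3_algEquiv (p := p) (q := q)
      (scaling a b c h) (by simp [Fin.forall_fin_succ, ha, hb, hc])
  simp only [← neg_one_smul k (sgen k p q r _)]
  refine ⟨main _ _ _ ?_ ?_ ?_ ?_, main _ _ _ ?_ ?_ ?_ ?_, main _ _ _ ?_ ?_ ?_ ?_⟩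
  case refine_4 | refine_8 | refine_12 =>
    refine hpq.imp_right fun h => ⟨?_, ?_, ?_⟩ <;> field_simp <;> rw [h]
  all_goals simp [hp, hq]
end
end

section
/- Let k be a field, (p,q,r) ∈ k³, and let θ ∈ k satisfy θ³ = 1 and θ ≠ 1. Set p' = θ²p + θq + r, q' = θp + θ²q + r, and r' = p + q + r. Then there is a k-algebra isomorphism S(p,q,r) → S(p',q',r') which maps the k-linear span of {x, y, z} onto the k-linear span of {x, y, z}; in particular the graded algebras S(p,q,r) and S(p',q',r') are isomorphic. -/
noncomputable section

variable (k : Type*) [Field k]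

/-- The elements `y 0, y 1, y 2` of a `k`-algebra satisfy the defining relations of `S(p,q,r)`. -/
def SatisfiesSklyanin {A : Type*} [Ring A] [Algebra k A] (p q r : k) (y : Fin 3 → A) : Prop :=
  p • (y 1 * y 2) + q • (y 2 * y 1) + r • (y 0 * y 0) = 0 ∧
  p • (y 2 * y 0) + q • (y 0 * y 2) + r • (y 1 * y 1) = 0 ∧
  p • (y 0 * y 1) + q • (y 1 * y 0) + r • (y 2 * y 2) = 0

/-- The unnormalized Fourier transform on triples, with respect to the powers of `θ`. -/
def fourier3 {M : Type*} [AddCommGroup M] [Module k M] (θ : k) (y : Fin 3 → M) : Fin 3 → M :=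
  ![y 0 + y 1 + y 2, y 0 + θ • y 1 + θ ^ 2 • y 2, y 0 + θ ^ 2 • y 1 + θ • y 2]

variable {k}

section Relations

variable {A : Type*} [Ring A] [Algebra k A]

theorem satisfiesSklyanin_sgen (p q r : k) : SatisfiesSklyanin k p q r (sgen k p q r) := by
  have h (a) (ha : sklyRel k p q r a 0) : RingQuot.mkAlgHom k (sklyRel k p q r) a = 0 := by
    rw [RingQuot.mkAlgHom_rel k ha, map_zero]
  refine ⟨?_, ?_, ?_⟩
  · simpa [sgen, Algebra.smul_def] using h _ ⟨rfl, Or.inl rfl⟩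
  · simpa [sgen, Algebra.smul_def] using h _ ⟨rfl, Or.inr (Or.inl rfl)⟩
  · simpa [sgen, Algebra.smul_def] using h _ ⟨rfl, Or.inr (Or.inr rfl)⟩

theorem SatisfiesSklyanin.exists_algHom {p q r : k} {y : Fin 3 → A}
    (hy : SatisfiesSklyanin k p q r y) :
    ∃ f : Skly3 k p q r →ₐ[k] A, ∀ i, f (sgen k p q r i) = y i := by
  obtain ⟨h0, h1, h2⟩ := hy
  refine ⟨RingQuot.liftAlgHom k ⟨FreeAlgebra.lift k y, ?_⟩, fun i => ?_⟩
  · rintro a b ⟨rfl, rfl | rfl | rfl⟩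
    · simpa [g3, Algebra.smul_def] using h0
    · simpa [g3, Algebra.smul_def] using h1
    · simpa [g3, Algebra.smul_def] using h2
  · simp [sgen, g3]

theorem Skly3.algHom_ext {p q r : k} {f g : Skly3 k p q r →ₐ[k] A}
    (h : ∀ i, f (sgen k p q r i) = g (sgen k p q r i)) : f = g := by
  apply RingQuot.ringQuot_ext'
  apply FreeAlgebra.hom_ext
  funext i
  exact h i

theorem SatisfiesSklyanin.smul_params {p q r : k} {y : Fin 3 → A}
    (hy : SatisfiesSklyanin k p q r y) (c : k) :
    SatisfiesSklyanin k (c * p) (c * q) (c * r) y := by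
  obtain ⟨h0, h1, h2⟩ := hy
  simp only [SatisfiesSklyanin, mul_smul, ← smul_add, h0, h1, h2, smul_zero, and_self]

theorem SatisfiesSklyanin.smul {p q r : k} {y : Fin 3 → A}
    (hy : SatisfiesSklyanin k p q r y) (c : k) : SatisfiesSklyanin k p q r (c • y) := by
  obtain ⟨h0, h1, h2⟩ := hy
  simp only [SatisfiesSklyanin, Pi.smul_apply, smul_mul_smul_comm, smul_comm _ (c * c),
    ← smul_add, h0, h1, h2, smul_zero, and_self]

theorem SatisfiesSklyanin.fourier3 {p q r θ : k} (hθ : θ ^ 2 + θ + 1 = 0) {y : Fin 3 → A}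
    (hy : SatisfiesSklyanin k (θ ^ 2 * p + θ * q + r) (θ * p + θ ^ 2 * q + r) (p + q + r) y) :
    SatisfiesSklyanin k p q r (fourier3 k θ y) := by
  obtain ⟨h0, h1, h2⟩ := hy
  simp only [SatisfiesSklyanin, _root_.fourier3, Matrix.cons_val, mul_add, add_mul,
    smul_mul_assoc, mul_smul_comm, smul_add, smul_smul]
  refine ⟨?_, ?_, ?_⟩
  · rw [← add_zero (0 : A), ← add_zero (0 + 0 : A)]
    nth_rewrite 1 [← h0]
    nth_rewrite 1 [← h1]
    rw [← h2]
    match_scalars <;> grind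
  · trans (0 : A) + θ ^ 2 • 0 + θ • 0
    · nth_rewrite 1 [← h0]
      nth_rewrite 1 [← h1]
      rw [← h2]
      match_scalars <;> grind
    · simp
  · trans (0 : A) + θ • 0 + θ ^ 2 • 0
    · nth_rewrite 1 [← h0]
      nth_rewrite 1 [← h1]
      rw [← h2]
      match_scalars <;> grind
    · simp

end Relations

section Fourier

variable {M N : Type*} [AddCommGroup M] [Module k M] [AddCommGroup N] [Module k N]

theorem map_fourier3 (f : M →ₗ[k] N) (θ : k) (y : Fin 3 → M) (i : Fin 3) :
    f (fourier3 k θ y i) = fourier3 k θ (f ∘ y) i := by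
  fin_cases i <;> simp [fourier3]

theorem fourier3_smul (c θ : k) (y : Fin 3 → M) :
    fourier3 k θ (c • y) = c • fourier3 k θ y := by
  funext i
  fin_cases i <;> simp [fourier3, smul_comm c]

theorem fourier3_fourier3 {θ : k} (hθ : θ ^ 2 + θ + 1 = 0) (y : Fin 3 → M) :
    fourier3 k (θ ^ 2) (fourier3 k θ y) = (3 : k) • y := by
  funext i
  fin_cases i <;> simp [fourier3] <;> match_scalars <;> grind

theorem fourier3_mem_span (θ : k) (y : Fin 3 → M) (i : Fin 3) :
    fourier3 k θ y i ∈ Submodule.span k (Set.range y) := by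
  have h (j) : y j ∈ Submodule.span k (Set.range y) := Submodule.subset_span ⟨j, rfl⟩
  fin_cases i <;>
    simp only [fourier3] <;>
    exact add_mem (add_mem (h 0) (by first | exact h 1 | exact Submodule.smul_mem _ _ (h 1)))
      (by first | exact h 2 | exact Submodule.smul_mem _ _ (h 2))

end Fourier

variable (k)

/-- For `θ` a nontrivial cube root of unity and `p' = θ²p + θq + r`, `q' = θp + θ²q + r`,
`r' = p + q + r`, there is a `k`-algebra isomorphism `S(p,q,r) → S(p',q',r')` mapping the
span of the degree-one generators onto the span of the degree-one generators; in particular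
the graded algebras `S(p,q,r)` and `S(p',q',r')` are isomorphic. -/
theorem sklyanin3_iso_parameter_change (p q r θ : k) (hθ3 : θ ^ 3 = 1) (hθ : θ ≠ 1) :
    ∃ e : Skly3 k p q r ≃ₐ[k]
        Skly3 k (θ ^ 2 * p + θ * q + r) (θ * p + θ ^ 2 * q + r) (p + q + r),
      Submodule.map e.toLinearMap (Submodule.span k (Set.range (sgen k p q r))) =
        Submodule.span k
          (Set.range (sgen k (θ ^ 2 * p + θ * q + r) (θ * p + θ ^ 2 * q + r) (p + q + r))) := by
  have hsum : θ ^ 2 + θ + 1 = 0 := by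
    have h : (θ - 1) * (θ ^ 2 + θ + 1) = 0 := by linear_combination hθ3
    exact (mul_eq_zero.mp h).resolve_left (sub_ne_zero.mpr hθ)
  have hsum' : (θ ^ 2) ^ 2 + θ ^ 2 + 1 = 0 := by linear_combination hsum + θ * hθ3
  have h3 : (3 : k) ≠ 0 := by
    intro h
    have h' : (θ - 1) ^ 2 = 0 := by linear_combination hsum - θ * h
    exact hθ (sub_eq_zero.mp (pow_eq_zero_iff two_ne_zero |>.mp h'))
  set p' := θ ^ 2 * p + θ * q + r with hp'
  set q' := θ * p + θ ^ 2 * q + r with hq'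
  set r' := p + q + r with hr'
  have hinv : SatisfiesSklyanin k p' q' r' ((3 : k)⁻¹ • fourier3 k (θ ^ 2) (sgen k p q r)) := by
    refine SatisfiesSklyanin.smul (SatisfiesSklyanin.fourier3 hsum' ?_) _
    convert (satisfiesSklyanin_sgen p q r).smul_params 3 using 1 <;> grind
  obtain ⟨f, hf⟩ := ((satisfiesSklyanin_sgen p' q' r').fourier3 hsum).exists_algHom
  obtain ⟨g, hg⟩ := hinv.exists_algHom
  have hf' : f.toLinearMap ∘ sgen k p q r = fourier3 k θ (sgen k p' q' r') := funext hf
  have hg' : g.toLinearMap ∘ sgen k p' q' r' =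
      (3 : k)⁻¹ • fourier3 k (θ ^ 2) (sgen k p q r) := funext hg
  have hθ4 : (θ ^ 2) ^ 2 = θ := by linear_combination θ * hθ3
  have hfg : f.comp g = AlgHom.id k _ := Skly3.algHom_ext fun i => by
    have := map_fourier3 f.toLinearMap (θ ^ 2) (sgen k p q r) i
    rw [hf', fourier3_fourier3 hsum] at this
    rw [AlgHom.comp_apply, hg, Pi.smul_apply, map_smul, ← AlgHom.toLinearMap_apply, this]
    simp [smul_smul, h3]
  have hgf : g.comp f = AlgHom.id k _ := Skly3.algHom_ext fun i => by
    have h := fourier3_fourier3 hsum' (sgen k p q r)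
    rw [hθ4] at h
    rw [AlgHom.comp_apply, hf, ← AlgHom.toLinearMap_apply, map_fourier3, hg', fourier3_smul, h]
    simp [smul_smul, h3]
  refine ⟨AlgEquiv.ofAlgHom f g hfg hgf, le_antisymm ?_ ?_⟩
  · rw [Submodule.map_span_le]
    rintro _ ⟨i, rfl⟩
    change f _ ∈ _
    rw [hf]
    exact fourier3_mem_span θ _ i
  · rw [Submodule.span_le]
    rintro _ ⟨i, rfl⟩
    refine ⟨g (sgen k p' q' r' i), ?_, DFunLike.congr_fun hfg _⟩
    rw [hg]
    exact Submodule.smul_mem _ _ (fourier3_mem_span _ _ i)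
end
end

section
/- Let k be a field possessing a primitive cube root of unity (so char(k) ≠ 3), and let (p,q,r) ∈ k³ be a nonzero degenerate triple with p = q. Then S(p,q,r) is isomorphic as a k-algebra to the monomial algebra k⟨x,y,z⟩/(x², y², z²). -/
noncomputable section

variable (k : Type*) [Field k]

/-- A nonzero triple `(p,q,r)` is degenerate if it is a scalar multiple of `(1,0,0)`,
`(0,1,0)` or `(0,0,1)`, or if `p³ = q³ = r³`. -/
def Degenerate (p q r : k) : Prop :=
  (q = 0 ∧ r = 0) ∨ (p = 0 ∧ r = 0) ∨ (p = 0 ∧ q = 0) ∨ (p ^ 3 = q ^ 3 ∧ q ^ 3 = r ^ 3)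

/-- The monomial algebra `k⟨x,y,z⟩/(x², y², z²)`. -/
abbrev MonSq : Type _ := RingQuot (fun a b : FreeAlgebra k (Fin 3) =>
  b = 0 ∧ (a = g3 k 0 * g3 k 0 ∨ a = g3 k 1 * g3 k 1 ∨ a = g3 k 2 * g3 k 2))

/-- An automorphism of `A` carrying each of two relations into the ring congruence generated by
the other one induces an isomorphism of the quotients. -/
def RingQuot.algEquivOfAlgEquiv {R A B : Type*} [CommSemiring R] [Semiring A] [Algebra R A]
    [Semiring B] [Algebra R B] {s : A → A → Prop} {t : B → B → Prop} (e : A ≃ₐ[R] B)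
    (hst : ∀ ⦃a b⦄, s a b → RingQuot.mkAlgHom R t (e a) = RingQuot.mkAlgHom R t (e b))
    (hts : ∀ ⦃a b⦄, t a b → RingQuot.mkAlgHom R s (e.symm a) = RingQuot.mkAlgHom R s (e.symm b)) :
    RingQuot s ≃ₐ[R] RingQuot t :=
  AlgEquiv.ofAlgHom
    (RingQuot.liftAlgHom R ⟨(RingQuot.mkAlgHom R t).comp e.toAlgHom,
      fun _ _ h ↦ by simpa using hst h⟩)
    (RingQuot.liftAlgHom R ⟨(RingQuot.mkAlgHom R s).comp e.symm.toAlgHom,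
      fun _ _ h ↦ by simpa using hts h⟩)
    (by
      apply RingQuot.ringQuot_ext'
      ext a
      simp)
    (by
      apply RingQuot.ringQuot_ext'
      ext a
      simp)

/-- The images of the generators `x, y, z` in `k⟨x,y,z⟩/(x², y², z²)`. -/
def MonSq.gen (i : Fin 3) : MonSq k :=
  RingQuot.mkAlgHom k _ (g3 k i)

theorem MonSq.mkAlgHom_g3 (i : Fin 3) :
    RingQuot.mkAlgHom k (fun a b : FreeAlgebra k (Fin 3) =>
      b = 0 ∧ (a = g3 k 0 * g3 k 0 ∨ a = g3 k 1 * g3 k 1 ∨ a = g3 k 2 * g3 k 2)) (g3 k i) =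
      MonSq.gen k i :=
  rfl

theorem MonSq.gen_mul_self (i : Fin 3) : MonSq.gen k i * MonSq.gen k i = 0 := by
  rw [MonSq.gen, ← map_mul, ← map_zero (RingQuot.mkAlgHom k _)]
  exact RingQuot.mkAlgHom_rel k ⟨rfl, by fin_cases i <;> simp⟩

theorem mkAlgHom_sklyRel_g3 (p q r : k) (i : Fin 3) :
    RingQuot.mkAlgHom k (sklyRel k p q r) (g3 k i) = sgen k p q r i :=
  rfl

theorem sgen_rel_x (p q r : k) :
    p • (sgen k p q r 1 * sgen k p q r 2) + q • (sgen k p q r 2 * sgen k p q r 1) +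
      r • (sgen k p q r 0 * sgen k p q r 0) = 0 := by
  simpa [sgen, Algebra.smul_def] using
    RingQuot.mkAlgHom_rel k (s := sklyRel k p q r) ⟨rfl, Or.inl rfl⟩

theorem sgen_rel_y (p q r : k) :
    p • (sgen k p q r 2 * sgen k p q r 0) + q • (sgen k p q r 0 * sgen k p q r 2) +
      r • (sgen k p q r 1 * sgen k p q r 1) = 0 := by
  simpa [sgen, Algebra.smul_def] using
    RingQuot.mkAlgHom_rel k (s := sklyRel k p q r) ⟨rfl, Or.inr (Or.inl rfl)⟩

theorem sgen_rel_z (p q r : k) :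
    p • (sgen k p q r 0 * sgen k p q r 1) + q • (sgen k p q r 1 * sgen k p q r 0) +
      r • (sgen k p q r 2 * sgen k p q r 2) = 0 := by
  simpa [sgen, Algebra.smul_def] using
    RingQuot.mkAlgHom_rel k (s := sklyRel k p q r) ⟨rfl, Or.inr (Or.inr rfl)⟩

theorem skly3_zero_zero_nonempty_algEquiv_monSq {r : k} (hr : r ≠ 0) :
    Nonempty (Skly3 k 0 0 r ≃ₐ[k] MonSq k) := by
  refine ⟨RingQuot.algEquivOfAlgEquiv AlgEquiv.refl ?_ ?_⟩
  · rintro a b ⟨rfl, rfl | rfl | rfl⟩ <;>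
      simp [← Algebra.smul_def, MonSq.mkAlgHom_g3, MonSq.gen_mul_self]
  · have h0 := sgen_rel_x k 0 0 r
    have h1 := sgen_rel_y k 0 0 r
    have h2 := sgen_rel_z k 0 0 r
    simp only [zero_smul, zero_add, smul_eq_zero, hr, false_or] at h0 h1 h2
    rintro a b ⟨rfl, rfl | rfl | rfl⟩ <;> simpa [mkAlgHom_sklyRel_g3]

section CubeRoots

variable {k}

theorem IsPrimitiveRoot.one_add_self_add_sq_eq_zero {ω : k} (hω : IsPrimitiveRoot ω 3) :
    1 + ω + ω ^ 2 = 0 := by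
  simpa [Finset.sum_range_succ] using hω.geom_sum_eq_zero (by norm_num)

theorem IsPrimitiveRoot.three_ne_zero {ω : k} (hω : IsPrimitiveRoot ω 3) : (3 : k) ≠ 0 := by
  intro h3
  have hsq : (ω - 1) ^ 2 = 0 := by
    linear_combination hω.one_add_self_add_sq_eq_zero - ω * h3
  exact hω.ne_one (by norm_num) (sub_eq_zero.mp (pow_eq_zero_iff two_ne_zero |>.mp hsq))

/-- The linear change of variables `x ↦ (x + y + z)/3`, `y ↦ (x + ω²y + ωz)/3`,
`z ↦ ζ(x + ωy + ω²z)/3` of `k⟨x,y,z⟩`. -/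
def FreeAlgebra.fourierEquiv {ω ζ : k} (hω : IsPrimitiveRoot ω 3) (hζ : ζ ^ 3 = 1) :
    FreeAlgebra k (Fin 3) ≃ₐ[k] FreeAlgebra k (Fin 3) :=
  AlgEquiv.ofAlgHom
    (FreeAlgebra.lift k ![(3 : k)⁻¹ • (g3 k 0 + g3 k 1 + g3 k 2),
      (3 : k)⁻¹ • (g3 k 0 + ω ^ 2 • g3 k 1 + ω • g3 k 2),
      ((3 : k)⁻¹ * ζ) • (g3 k 0 + ω • g3 k 1 + ω ^ 2 • g3 k 2)])
    (FreeAlgebra.lift k ![g3 k 0 + g3 k 1 + ζ ^ 2 • g3 k 2,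
      g3 k 0 + ω • g3 k 1 + (ζ ^ 2 * ω ^ 2) • g3 k 2,
      g3 k 0 + ω ^ 2 • g3 k 1 + (ζ ^ 2 * ω) • g3 k 2])
    (by
      have h3 := mul_inv_cancel₀ hω.three_ne_zero
      have h1 := hω.one_add_self_add_sq_eq_zero
      have hω3 := hω.pow_eq_one
      ext i
      fin_cases i <;> simp [g3] <;> match_scalars <;> grind)
    (by
      have h3 := mul_inv_cancel₀ hω.three_ne_zero
      have h1 := hω.one_add_self_add_sq_eq_zero
      have hω3 := hω.pow_eq_one
      ext i
      fin_cases i <;> simp [g3] <;> match_scalars <;> grind)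

/-- The square of a suitable linear form is a combination of the three defining relations of
`S(p,p,pζ)`. -/
theorem mul_self_linear_form_eq_zero {A : Type*} [Ring A] [Algebra k A] {p ζ b c : k}
    (hp : p ≠ 0) (hζ : ζ ^ 3 = 1) (hb : b ^ 3 = 1) (hc : c = ζ ^ 2 * b ^ 2) {x y z : A}
    (hx : p • (y * z) + p • (z * y) + (p * ζ) • (x * x) = 0)
    (hy : p • (z * x) + p • (x * z) + (p * ζ) • (y * y) = 0)
    (hz : p • (x * y) + p • (y * x) + (p * ζ) • (z * z) = 0) :
    (x + b • y + c • z) * (x + b • y + c • z) = 0 := by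
  simp only [mul_add, add_mul, smul_mul_assoc, mul_smul_comm, smul_add, smul_smul]
  linear_combination (norm := (match_scalars <;> grind))
    (p⁻¹ * ζ ^ 2) • hx + (p⁻¹ * c) • hy + (p⁻¹ * b) • hz

/-- If `x, y, z` square to zero, then suitable linear forms in them satisfy a defining relation
of `S(p,p,pζ)`. -/
theorem linear_forms_sklyanin_relation {A : Type*} [Ring A] [Algebra k A]
    {a b c a' b' c' p ζ r s t : k} (hsum : a + b + c = 0) (hab : a * b = c ^ 2)
    (ha : a' = a ^ 2) (hb : b' = b ^ 2) (hc : c' = c ^ 2) (hrs : r * s = ζ * t ^ 2) {x y z : A}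
    (hx : x * x = 0) (hy : y * y = 0) (hz : z * z = 0) :
    p • (r • (x + a • y + a' • z) * s • (x + b • y + b' • z)) +
      p • (s • (x + b • y + b' • z) * r • (x + a • y + a' • z)) +
      (p * ζ) • (t • (x + c • y + c' • z) * t • (x + c • y + c' • z)) = 0 := by
  have key : (x + a • y + a' • z) * (x + b • y + b' • z) +
      (x + b • y + b' • z) * (x + a • y + a' • z) +
      (x + c • y + c' • z) * (x + c • y + c' • z) = 0 := by
    subst ha hb hc
    simp only [mul_add, add_mul, smul_mul_assoc, mul_smul_comm, smul_add, smul_smul, hx, hy, hz,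
      smul_zero]
    match_scalars <;> grind
  have hscal : p * ζ * (t * t) = p * (r * s) := by rw [hrs]; ring
  rw [smul_mul_smul_comm, smul_mul_smul_comm, smul_mul_smul_comm, smul_smul, smul_smul, smul_smul,
    hscal, mul_comm s r, ← smul_add, ← smul_add, key, smul_zero]

variable {ω ζ : k} (hω : IsPrimitiveRoot ω 3) (hζ : ζ ^ 3 = 1)

@[simp]
theorem FreeAlgebra.fourierEquiv_g3_zero :
    fourierEquiv hω hζ (g3 k 0) = (3 : k)⁻¹ • (g3 k 0 + g3 k 1 + g3 k 2) := by
  simp [fourierEquiv, g3]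

@[simp]
theorem FreeAlgebra.fourierEquiv_g3_one :
    fourierEquiv hω hζ (g3 k 1) = (3 : k)⁻¹ • (g3 k 0 + ω ^ 2 • g3 k 1 + ω • g3 k 2) := by
  simp [fourierEquiv, g3]

@[simp]
theorem FreeAlgebra.fourierEquiv_g3_two :
    fourierEquiv hω hζ (g3 k 2) =
      ((3 : k)⁻¹ * ζ) • (g3 k 0 + ω • g3 k 1 + ω ^ 2 • g3 k 2) := by
  simp [fourierEquiv, g3]

@[simp]
theorem FreeAlgebra.fourierEquiv_symm_g3_zero :
    (fourierEquiv hω hζ).symm (g3 k 0) = g3 k 0 + g3 k 1 + ζ ^ 2 • g3 k 2 := by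
  simp [fourierEquiv, g3]

@[simp]
theorem FreeAlgebra.fourierEquiv_symm_g3_one :
    (fourierEquiv hω hζ).symm (g3 k 1) = g3 k 0 + ω • g3 k 1 + (ζ ^ 2 * ω ^ 2) • g3 k 2 := by
  simp [fourierEquiv, g3]

@[simp]
theorem FreeAlgebra.fourierEquiv_symm_g3_two :
    (fourierEquiv hω hζ).symm (g3 k 2) = g3 k 0 + ω ^ 2 • g3 k 1 + (ζ ^ 2 * ω) • g3 k 2 := by
  simp [fourierEquiv, g3]

theorem skly3_nonempty_algEquiv_monSq {ω ζ p : k} (hω : IsPrimitiveRoot ω 3) (hζ : ζ ^ 3 = 1)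
    (hp : p ≠ 0) :
    Nonempty (Skly3 k p p (p * ζ) ≃ₐ[k] MonSq k) := by
  have hs := hω.one_add_self_add_sq_eq_zero
  have hω3 := hω.pow_eq_one
  refine ⟨RingQuot.algEquivOfAlgEquiv (FreeAlgebra.fourierEquiv hω hζ) ?_ ?_⟩
  · have hx := MonSq.gen_mul_self k 0
    have hy := MonSq.gen_mul_self k 1
    have hz := MonSq.gen_mul_self k 2
    rintro a b ⟨rfl, rfl | rfl | rfl⟩ <;>
      simp only [← Algebra.smul_def] <;>
      simp only [FreeAlgebra.fourierEquiv_g3_zero, FreeAlgebra.fourierEquiv_g3_one,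
        FreeAlgebra.fourierEquiv_g3_two, map_add, map_mul, map_smul, map_zero,
        MonSq.mkAlgHom_g3]
    · simpa only [one_smul] using linear_forms_sklyanin_relation (a := ω ^ 2) (b := ω) (c := 1)
        (a' := ω) (b' := ω ^ 2) (c' := 1) (p := p) (ζ := ζ) (r := 3⁻¹) (s := 3⁻¹ * ζ) (t := 3⁻¹)
        (by grind) (by grind) (by grind) rfl (by ring) (by ring) hx hy hz
    · simpa only [one_smul] using linear_forms_sklyanin_relation (a := ω) (b := 1) (c := ω ^ 2)
        (a' := ω ^ 2) (b' := 1) (c' := ω) (p := p) (ζ := ζ) (r := 3⁻¹ * ζ) (s := 3⁻¹) (t := 3⁻¹)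
        (by grind) (by grind) rfl (by ring) (by grind) (by ring) hx hy hz
    · simpa only [one_smul] using linear_forms_sklyanin_relation (a := 1) (b := ω ^ 2) (c := ω)
        (a' := 1) (b' := ω) (c' := ω ^ 2) (p := p) (ζ := ζ) (r := 3⁻¹) (s := 3⁻¹) (t := 3⁻¹ * ζ)
        (by grind) (by ring) (by ring) (by grind) rfl (by grind) hx hy hz
  · have hx := sgen_rel_x k p p (p * ζ)
    have hy := sgen_rel_y k p p (p * ζ)
    have hz := sgen_rel_z k p p (p * ζ)
    rintro a b ⟨rfl, rfl | rfl | rfl⟩ <;>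
      simp only [FreeAlgebra.fourierEquiv_symm_g3_zero, FreeAlgebra.fourierEquiv_symm_g3_one,
        FreeAlgebra.fourierEquiv_symm_g3_two, map_add, map_mul, map_smul, map_zero,
        mkAlgHom_sklyRel_g3]
    · simpa using mul_self_linear_form_eq_zero hp hζ (one_pow 3) (by ring) hx hy hz
    · exact mul_self_linear_form_eq_zero hp hζ hω3 rfl hx hy hz
    · exact mul_self_linear_form_eq_zero hp hζ (by grind) (by grind) hx hy hz

end CubeRoots

/-- If `k` has a primitive cube root of unity and `(p,q,r)` is a nonzero degenerate triple
with `p = q`, then `S(p,q,r) ≅ k⟨x,y,z⟩/(x², y², z²)` as `k`-algebras. -/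
theorem degenerate_sklyanin3_iso_of_eq (hroot : ∃ ω : k, IsPrimitiveRoot ω 3)
    (p q r : k) (hne : ¬(p = 0 ∧ q = 0 ∧ r = 0)) (hdeg : Degenerate k p q r)
    (hpq : p = q) :
    Nonempty (Skly3 k p q r ≃ₐ[k] MonSq k) := by
  obtain ⟨ω, hω⟩ := hroot
  subst hpq
  by_cases hp : p = 0
  · subst hp
    have hr : r ≠ 0 := by simpa using hne
    exact skly3_zero_zero_nonempty_algEquiv_monSq k hr
  · obtain ⟨ζ, rfl⟩ : ∃ ζ, r = p * ζ := ⟨r / p, by field_simp⟩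
    have hζ : ζ ^ 3 = 1 := by
      rcases hdeg with h | h | h | h
      · exact absurd h.1 hp
      · exact absurd h.1 hp
      · exact absurd h.1 hp
      · have := h.2
        rw [mul_pow] at this
        exact (mul_eq_left₀ (pow_ne_zero 3 hp)).mp this.symm
    exact skly3_nonempty_algEquiv_monSq hω hζ hp
end
end

section
/- Let k be a field possessing a primitive cube root of unity (so char(k) ≠ 3), and let (p,q,r) ∈ k³ be a nonzero degenerate triple with p ≠ q. Then S(p,q,r) is isomorphic as a k-algebra to the monomial algebra k⟨x,y,z⟩/(xy, yz, zx). -/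
noncomputable section

variable (k : Type*) [Field k]

/-- The monomial algebra `k⟨x,y,z⟩/(xy, yz, zx)`. -/
abbrev MonCyc : Type _ := RingQuot (fun a b : FreeAlgebra k (Fin 3) =>
  b = 0 ∧ (a = g3 k 0 * g3 k 1 ∨ a = g3 k 1 * g3 k 2 ∨ a = g3 k 2 * g3 k 0))

/-- A change of generators of the free algebra that carries the relations `R` to
consequences of `S`, and whose inverse carries `S` to consequences of `R`, induces an isomorphism
of the quotients. -/
theorem nonempty_ringQuot_algEquiv {X : Type*} {R S : FreeAlgebra k X → FreeAlgebra k X → Prop}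
    (f g : X → FreeAlgebra k X)
    (hf : ∀ a b, R a b → RingQuot.mkAlgHom k S (FreeAlgebra.lift k f a) =
      RingQuot.mkAlgHom k S (FreeAlgebra.lift k f b))
    (hg : ∀ a b, S a b → RingQuot.mkAlgHom k R (FreeAlgebra.lift k g a) =
      RingQuot.mkAlgHom k R (FreeAlgebra.lift k g b))
    (hfg : ∀ i, FreeAlgebra.lift k f (g i) = FreeAlgebra.ι k i)
    (hgf : ∀ i, FreeAlgebra.lift k g (f i) = FreeAlgebra.ι k i) :
    Nonempty (RingQuot R ≃ₐ[k] RingQuot S) := by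
  let F : RingQuot R →ₐ[k] RingQuot S := RingQuot.liftAlgHom k
    ⟨(RingQuot.mkAlgHom k S).comp (FreeAlgebra.lift k f), fun a b h => hf a b h⟩
  let G : RingQuot S →ₐ[k] RingQuot R := RingQuot.liftAlgHom k
    ⟨(RingQuot.mkAlgHom k R).comp (FreeAlgebra.lift k g), fun a b h => hg a b h⟩
  have hF (a) : F (RingQuot.mkAlgHom k R a) = RingQuot.mkAlgHom k S (FreeAlgebra.lift k f a) :=
    RingQuot.liftAlgHom_mkAlgHom_apply ..
  have hG (a) : G (RingQuot.mkAlgHom k S a) = RingQuot.mkAlgHom k R (FreeAlgebra.lift k g a) :=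
    RingQuot.liftAlgHom_mkAlgHom_apply ..
  refine ⟨AlgEquiv.ofAlgHom F G ?_ ?_⟩ <;>
  · apply RingQuot.ringQuot_ext'
    apply FreeAlgebra.hom_ext
    funext i
    simp [hF, hG, hfg, hgf]

/-- The linear forms diagonalising the relations of the degenerate Sklyanin algebra
`S(1, ω, ρ)`. -/
def splitForms {k A : Type*} [Field k] [Ring A] [Algebra k A] (ω ρ : k) (v : Fin 3 → A) :
    Fin 3 → A :=
  ![v 0 + ω ^ 2 • v 1 + ρ ^ 2 • v 2,
    v 0 + ω • v 1 + (ω * ρ ^ 2) • v 2,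
    v 0 + v 1 + (ω ^ 2 * ρ ^ 2) • v 2]

/-- The change of generators inverse to `splitForms`. -/
def mergeForms {k A : Type*} [Field k] [Ring A] [Algebra k A] (ω ρ : k) (v : Fin 3 → A) :
    Fin 3 → A :=
  ![(3⁻¹ : k) • (v 0 + v 1 + v 2),
    (3⁻¹ : k) • (ω • v 0 + ω ^ 2 • v 1 + v 2),
    (3⁻¹ * ρ : k) • (v 0 + ω ^ 2 • v 1 + ω • v 2)]

section

variable {k A B : Type*} [Field k] [Ring A] [Algebra k A] [Ring B] [Algebra k B] {ω ρ : k}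

theorem map_splitForms (φ : A →ₐ[k] B) (v : Fin 3 → A) (i : Fin 3) :
    φ (splitForms ω ρ v i) = splitForms ω ρ (fun j => φ (v j)) i := by
  fin_cases i <;> simp [splitForms]

theorem map_mergeForms (φ : A →ₐ[k] B) (v : Fin 3 → A) (i : Fin 3) :
    φ (mergeForms ω ρ v i) = mergeForms ω ρ (fun j => φ (v j)) i := by
  fin_cases i <;> simp [mergeForms]

theorem three_ne_zero_of_sq_add_self_add_one (hω : ω ^ 2 + ω + 1 = 0) (hω1 : ω ≠ 1) :
    (3 : k) ≠ 0 := by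
  intro h3
  have : (ω - 1) ^ 2 = 0 := by linear_combination hω - ω * h3
  exact hω1 (sub_eq_zero.mp (pow_eq_zero_iff two_ne_zero |>.mp this))

theorem mergeForms_splitForms (hω : ω ^ 2 + ω + 1 = 0) (hρ : ρ ^ 3 = 1) (h3 : (3 : k) ≠ 0)
    (v : Fin 3 → A) : mergeForms ω ρ (splitForms ω ρ v) = v := by
  funext i
  fin_cases i <;> simp only [mergeForms, splitForms, Fin.zero_eta, Fin.mk_one, Fin.reduceFinMk,
    Matrix.cons_val] <;> match_scalars <;> grind

theorem splitForms_mergeForms (hω : ω ^ 2 + ω + 1 = 0) (hρ : ρ ^ 3 = 1) (h3 : (3 : k) ≠ 0)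
    (v : Fin 3 → A) : splitForms ω ρ (mergeForms ω ρ v) = v := by
  funext i
  fin_cases i <;> simp only [mergeForms, splitForms, Fin.zero_eta, Fin.mk_one, Fin.reduceFinMk,
    Matrix.cons_val] <;> match_scalars <;> grind

/-- The defining relations of `S(1, ω, ρ)` are spanned by the products of consecutive
`splitForms`. -/
theorem splitForms_mul (hω : ω ^ 2 + ω + 1 = 0) (hρ : ρ ^ 3 = 1) (v : Fin 3 → A)
    (h₀ : v 1 * v 2 + ω • (v 2 * v 1) + ρ • (v 0 * v 0) = 0)
    (h₁ : v 2 * v 0 + ω • (v 0 * v 2) + ρ • (v 1 * v 1) = 0)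
    (h₂ : v 0 * v 1 + ω • (v 1 * v 0) + ρ • (v 2 * v 2) = 0) :
    splitForms ω ρ v 0 * splitForms ω ρ v 1 = 0 ∧
    splitForms ω ρ v 1 * splitForms ω ρ v 2 = 0 ∧
    splitForms ω ρ v 2 * splitForms ω ρ v 0 = 0 := by
  simp only [splitForms, Matrix.cons_val, mul_add, add_mul, smul_mul_assoc, mul_smul_comm]
  refine ⟨?_, ?_, ?_⟩
  · linear_combination (norm := skip) ρ ^ 2 • h₀ + ρ ^ 2 • h₁ + ω • h₂
    match_scalars <;> grind
  · linear_combination (norm := skip) ρ ^ 2 • h₀ + (ρ ^ 2 * ω) • h₁ + (1 : k) • h₂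
    match_scalars <;> grind
  · linear_combination (norm := skip) ρ ^ 2 • h₀ + (ρ ^ 2 * ω ^ 2) • h₁ + (ω ^ 2) • h₂
    match_scalars <;> grind

theorem mergeForms_relations (hω : ω ^ 2 + ω + 1 = 0) (hρ : ρ ^ 3 = 1) (v : Fin 3 → A)
    (h₀ : v 0 * v 1 = 0) (h₁ : v 1 * v 2 = 0) (h₂ : v 2 * v 0 = 0) :
    let w := mergeForms ω ρ v
    w 1 * w 2 + ω • (w 2 * w 1) + ρ • (w 0 * w 0) = 0 ∧
    w 2 * w 0 + ω • (w 0 * w 2) + ρ • (w 1 * w 1) = 0 ∧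
    w 0 * w 1 + ω • (w 1 * w 0) + ρ • (w 2 * w 2) = 0 := by
  simp only [mergeForms, Matrix.cons_val, mul_add, add_mul, smul_mul_assoc, mul_smul_comm,
    smul_smul, smul_add, h₀, h₁, h₂, smul_zero]
  refine ⟨?_, ?_, ?_⟩ <;> match_scalars <;> grind

end

/-- Mutually inverse changes of generators that exchange the relations of `S(p, q, r)` and those of
the monomial algebra give an isomorphism. -/
theorem nonempty_skly3_algEquiv_monCyc_of_forms {p q r : k} (f g : Fin 3 → FreeAlgebra k (Fin 3))
    (hf : ∀ φ : FreeAlgebra k (Fin 3) →ₐ[k] MonCyc k,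
      φ (g3 k 0) * φ (g3 k 1) = 0 → φ (g3 k 1) * φ (g3 k 2) = 0 → φ (g3 k 2) * φ (g3 k 0) = 0 →
      p • (φ (f 1) * φ (f 2)) + q • (φ (f 2) * φ (f 1)) + r • (φ (f 0) * φ (f 0)) = 0 ∧
      p • (φ (f 2) * φ (f 0)) + q • (φ (f 0) * φ (f 2)) + r • (φ (f 1) * φ (f 1)) = 0 ∧
      p • (φ (f 0) * φ (f 1)) + q • (φ (f 1) * φ (f 0)) + r • (φ (f 2) * φ (f 2)) = 0)
    (hg : ∀ φ : FreeAlgebra k (Fin 3) →ₐ[k] Skly3 k p q r,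
      p • (φ (g3 k 1) * φ (g3 k 2)) + q • (φ (g3 k 2) * φ (g3 k 1))
        + r • (φ (g3 k 0) * φ (g3 k 0)) = 0 →
      p • (φ (g3 k 2) * φ (g3 k 0)) + q • (φ (g3 k 0) * φ (g3 k 2))
        + r • (φ (g3 k 1) * φ (g3 k 1)) = 0 →
      p • (φ (g3 k 0) * φ (g3 k 1)) + q • (φ (g3 k 1) * φ (g3 k 0))
        + r • (φ (g3 k 2) * φ (g3 k 2)) = 0 →
      φ (g 0) * φ (g 1) = 0 ∧ φ (g 1) * φ (g 2) = 0 ∧ φ (g 2) * φ (g 0) = 0)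
    (hfg : ∀ i, FreeAlgebra.lift k f (g i) = FreeAlgebra.ι k i)
    (hgf : ∀ i, FreeAlgebra.lift k g (f i) = FreeAlgebra.ι k i) :
    Nonempty (Skly3 k p q r ≃ₐ[k] MonCyc k) := by
  refine nonempty_ringQuot_algEquiv k f g ?_ ?_ hfg hgf
  · set S : FreeAlgebra k (Fin 3) → FreeAlgebra k (Fin 3) → Prop := fun a b =>
      b = 0 ∧ (a = g3 k 0 * g3 k 1 ∨ a = g3 k 1 * g3 k 2 ∨ a = g3 k 2 * g3 k 0) with hS
    have h {a} (ha : S a 0) : RingQuot.mkAlgHom k S a = 0 := by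
      simpa using RingQuot.mkAlgHom_rel k ha
    obtain ⟨e₀, e₁, e₂⟩ := hf (RingQuot.mkAlgHom k S)
      (by simpa using h (a := g3 k 0 * g3 k 1) (by simp [hS]))
      (by simpa using h (a := g3 k 1 * g3 k 2) (by simp [hS]))
      (by simpa using h (a := g3 k 2 * g3 k 0) (by simp [hS]))
    rintro a b ⟨rfl, rfl | rfl | rfl⟩
    · simpa [g3, ← Algebra.smul_def] using e₀
    · simpa [g3, ← Algebra.smul_def] using e₁
    · simpa [g3, ← Algebra.smul_def] using e₂
  · have h {a} (ha : sklyRel k p q r a 0) : RingQuot.mkAlgHom k (sklyRel k p q r) a = 0 := by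
      simpa using RingQuot.mkAlgHom_rel k ha
    obtain ⟨e₀, e₁, e₂⟩ := hg (RingQuot.mkAlgHom k (sklyRel k p q r))
      (by simpa [← Algebra.smul_def] using h ⟨rfl, .inl rfl⟩)
      (by simpa [← Algebra.smul_def] using h ⟨rfl, .inr (.inl rfl)⟩)
      (by simpa [← Algebra.smul_def] using h ⟨rfl, .inr (.inr rfl)⟩)
    rintro a b ⟨rfl, rfl | rfl | rfl⟩
    · simpa [g3] using e₀
    · simpa [g3] using e₁
    · simpa [g3] using e₂

/-- A Sklyanin algebra `S(p, pω, pρ)` with `ω` a primitive and `ρ` an arbitrary cube root of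
unity is a monomial algebra. -/
theorem nonempty_skly3_algEquiv_monCyc {p ω ρ : k} (hp : p ≠ 0) (hω : ω ^ 2 + ω + 1 = 0)
    (hω1 : ω ≠ 1) (hρ : ρ ^ 3 = 1) :
    Nonempty (Skly3 k p (p * ω) (p * ρ) ≃ₐ[k] MonCyc k) := by
  have h3 := three_ne_zero_of_sq_add_self_add_one hω hω1
  refine nonempty_skly3_algEquiv_monCyc_of_forms k (mergeForms ω ρ (FreeAlgebra.ι k))
    (splitForms ω ρ (FreeAlgebra.ι k)) ?_ ?_ ?_ ?_
  · intro φ h₀ h₁ h₂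
    simpa [map_mergeForms, mul_smul, ← smul_add, hp] using
      mergeForms_relations hω hρ (fun i => φ (FreeAlgebra.ι k i)) h₀ h₁ h₂
  · intro φ h₀ h₁ h₂
    simp only [mul_smul, ← smul_add, smul_eq_zero, hp, false_or] at h₀ h₁ h₂
    simpa [map_splitForms] using splitForms_mul hω hρ (fun i => φ (FreeAlgebra.ι k i)) h₀ h₁ h₂
  · intro i
    simp [map_splitForms, splitForms_mergeForms hω hρ h3]
  · intro i
    simp [map_mergeForms, mergeForms_splitForms hω hρ h3]

theorem nonempty_skly3_algEquiv_monCyc_of_left {p : k} (hp : p ≠ 0) :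
    Nonempty (Skly3 k p 0 0 ≃ₐ[k] MonCyc k) := by
  refine nonempty_skly3_algEquiv_monCyc_of_forms k (FreeAlgebra.ι k) (FreeAlgebra.ι k)
    ?_ ?_ (by simp) (by simp) <;>
  · intro φ h₀ h₁ h₂
    simp_all [g3]

theorem nonempty_skly3_algEquiv_monCyc_of_right {q : k} (hq : q ≠ 0) :
    Nonempty (Skly3 k 0 q 0 ≃ₐ[k] MonCyc k) := by
  refine nonempty_skly3_algEquiv_monCyc_of_forms k
    (fun i => FreeAlgebra.ι k (Equiv.swap 1 2 i)) (fun i => FreeAlgebra.ι k (Equiv.swap 1 2 i))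
    ?_ ?_ (by simp) (by simp) <;>
  · intro φ h₀ h₁ h₂
    have h : Equiv.swap (1 : Fin 3) 2 0 = 0 := by decide
    simp_all [g3]

/-- If `k` has a primitive cube root of unity and `(p,q,r)` is a nonzero degenerate triple
with `p ≠ q`, then `S(p,q,r) ≅ k⟨x,y,z⟩/(xy, yz, zx)` as `k`-algebras. -/
theorem degenerate_sklyanin3_iso_of_ne (hroot : ∃ ω : k, IsPrimitiveRoot ω 3)
    (p q r : k) (hne : ¬(p = 0 ∧ q = 0 ∧ r = 0)) (hdeg : Degenerate k p q r)
    (hpq : p ≠ q) :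
    Nonempty (Skly3 k p q r ≃ₐ[k] MonCyc k) := by
  rcases hdeg with ⟨rfl, rfl⟩ | ⟨rfl, rfl⟩ | ⟨rfl, rfl⟩ | ⟨h₁, h₂⟩
  · exact nonempty_skly3_algEquiv_monCyc_of_left k hpq
  · exact nonempty_skly3_algEquiv_monCyc_of_right k hpq.symm
  · exact absurd rfl hpq
  · have hp : p ≠ 0 := by
      rintro rfl
      have hq : q = 0 := by simpa using h₁.symm
      subst hq
      exact hpq rfl
    have hω1 : q / p ≠ 1 := fun h => hpq ((div_eq_one_iff_eq hp).mp h).symm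
    have hω3 : (q / p) ^ 3 = 1 := by rw [div_pow, ← h₁, div_self (pow_ne_zero 3 hp)]
    have hρ : (r / p) ^ 3 = 1 := by rw [div_pow, ← h₂, ← h₁, div_self (pow_ne_zero 3 hp)]
    have hω : (q / p) ^ 2 + q / p + 1 = 0 := by
      apply mul_left_cancel₀ (sub_ne_zero.mpr hω1)
      linear_combination hω3
    have h := nonempty_skly3_algEquiv_monCyc k hp hω hω1 hρ
    rwa [mul_div_cancel₀ _ hp, mul_div_cancel₀ _ hp] at h
end
end

section
/- Let k be an algebraically closed field of characteristic different from 2 and let (α,β,γ) ∈ k³ satisfy α+β+γ+αβγ = 0, and assume that none of the following holds: (α = −1 and β = 1), (β = −1 and γ = 1), (α = 1 and γ = −1). Then for every natural number n, the image in S(α,β,γ) of the k-linear span of all words of length n in the generators x₀, x₁, x₂, x₃ has k-vector space dimension equal to the binomial coefficient C(n+3, 3) = (n+1)(n+2)(n+3)/6; that is, S(α,β,γ) has the Hilbert series 1/(1−t)⁴ of a commutative polynomial ring in 4 variables. -/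
noncomputable section

variable (k : Type*) [Field k]

/-- The generators `x₀, x₁, x₂, x₃` of the free algebra `k⟨x₀,x₁,x₂,x₃⟩`. -/
def g4 (i : Fin 4) : FreeAlgebra k (Fin 4) := FreeAlgebra.ι k i

/-- The relation whose induced ring quotient is the quotient of `k⟨x₀,x₁,x₂,x₃⟩` by the
two-sided ideal generated by the six defining elements of `A(α,β,γ)`. -/
def fourRel (α β γ : k) : FreeAlgebra k (Fin 4) → FreeAlgebra k (Fin 4) → Prop := fun a b =>
  b = 0 ∧
    (a = g4 k 0 * g4 k 1 - g4 k 1 * g4 k 0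
          - algebraMap k _ α * (g4 k 2 * g4 k 3 + g4 k 3 * g4 k 2) ∨
     a = g4 k 0 * g4 k 1 + g4 k 1 * g4 k 0 - (g4 k 2 * g4 k 3 - g4 k 3 * g4 k 2) ∨
     a = g4 k 0 * g4 k 2 - g4 k 2 * g4 k 0
          - algebraMap k _ β * (g4 k 3 * g4 k 1 + g4 k 1 * g4 k 3) ∨
     a = g4 k 0 * g4 k 2 + g4 k 2 * g4 k 0 - (g4 k 3 * g4 k 1 - g4 k 1 * g4 k 3) ∨
     a = g4 k 0 * g4 k 3 - g4 k 3 * g4 k 0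
          - algebraMap k _ γ * (g4 k 1 * g4 k 2 + g4 k 2 * g4 k 1) ∨
     a = g4 k 0 * g4 k 3 + g4 k 3 * g4 k 0 - (g4 k 1 * g4 k 2 - g4 k 2 * g4 k 1))

/-- The algebra `A(α,β,γ)`; when `α+β+γ+αβγ = 0` this is the four-dimensional Sklyanin
algebra `S(α,β,γ)`. -/
abbrev SklyA (α β γ : k) : Type _ := RingQuot (fourRel k α β γ)

/-- The images of the generators `x₀, x₁, x₂, x₃` in `A(α,β,γ)`. -/
def agen (α β γ : k) (i : Fin 4) : SklyA k α β γ :=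
  RingQuot.mkAlgHom k (fourRel k α β γ) (g4 k i)

/-- The image in `A(α,β,γ)` of the `k`-linear span of all words of length `n` in the
generators. -/
def gradedPiece4 (α β γ : k) (n : ℕ) : Submodule k (SklyA k α β γ) :=
  Submodule.span k
    {s : SklyA k α β γ | ∃ w : List (Fin 4), w.length = n ∧ s = (w.map (agen k α β γ)).prod}

section Bounds
variable {K A : Type*} [Field K] [Ring A] [Algebra K A]

/-- The degree `n` part of the right ideal generated by `W`, a space of elements of degree one,
in an algebra whose degree `n` part is `V ^ n`. -/
def rightIdealPart (W V : Submodule K A) : ℕ → Submodule K A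
  | 0 => ⊥
  | n + 1 => W * V ^ n

/-- The degree `n` part of the cyclic right module `A / W A` is spanned by `d` elements. -/
def QuotBound (W V : Submodule K A) (n d : ℕ) : Prop :=
  ∃ s : Finset A, s.card ≤ d ∧ V ^ n ≤ rightIdealPart W V n ⊔ Submodule.span K (s : Set A)

theorem QuotBound.zero (W V : Submodule K A) {d : ℕ} (hd : 1 ≤ d) : QuotBound W V 0 d := by
  refine ⟨{1}, by simpa using hd, ?_⟩
  rw [pow_zero, Submodule.one_eq_span]
  simp

theorem span_singleton_mul_rightIdealPart_le {W U V : Submodule K A} {l : A}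
    (hU : Submodule.span K {l} * U ≤ W * V) (n : ℕ) :
    Submodule.span K {l} * rightIdealPart U V n ≤ W * V ^ n := by
  cases n with
  | zero => simp [rightIdealPart]
  | succ n =>
    calc Submodule.span K {l} * (U * V ^ n) = Submodule.span K {l} * U * V ^ n :=
          (mul_assoc _ _ _).symm
      _ ≤ W * V * V ^ n := mul_le_mul' hU le_rfl
      _ = W * V ^ (n + 1) := by rw [mul_assoc, pow_succ']

theorem QuotBound.step {W U V : Submodule K A} {l : A}
    (hU : Submodule.span K {l} * U ≤ W * V) {n d e : ℕ}
    (h₁ : QuotBound (W ⊔ Submodule.span K {l}) V (n + 1) d) (h₂ : QuotBound U V n e) :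
    QuotBound W V (n + 1) (d + e) := by
  classical
  obtain ⟨s, hs, hs'⟩ := h₁
  obtain ⟨t, ht, ht'⟩ := h₂
  refine ⟨s ∪ t.image (l * ·), (Finset.card_union_le _ _).trans
    (add_le_add hs (Finset.card_image_le.trans ht)), hs'.trans ?_⟩
  have hl : Submodule.span K {l} * V ^ n ≤
      W * V ^ n ⊔ Submodule.span K ((t.image (l * ·) : Finset A) : Set A) := by
    refine (mul_le_mul' le_rfl ht').trans ?_
    rw [Submodule.mul_sup]
    refine sup_le_sup (span_singleton_mul_rightIdealPart_le hU n) ?_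
    rw [Submodule.span_mul_span, Finset.coe_image, Set.singleton_mul]
  rw [Finset.coe_union, Submodule.span_union]
  simp only [rightIdealPart]
  rw [Submodule.sup_mul]
  refine sup_le (sup_le (le_sup_left) (hl.trans ?_)) (le_sup_of_le_right le_sup_left)
  exact sup_le_sup le_rfl le_sup_right

theorem QuotBound.finrank_le {V : Submodule K A} {n d : ℕ} (h : QuotBound ⊥ V n d) :
    Module.finrank K ↥(V ^ n) ≤ d := by
  obtain ⟨s, hs, h⟩ := h
  have : rightIdealPart ⊥ V n = ⊥ := by cases n <;> simp [rightIdealPart]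
  rw [this, bot_sup_eq] at h
  exact (Submodule.finrank_mono h).trans ((finrank_span_finset_le_card s).trans hs)

/-- A flag of right ideals `P A ⊆ P A + L A ⊆ P A + L A + X A` with the commutation rules below
and last quotient of dimension at most one in each degree. -/
theorem quotBound_of_flag {V : Submodule K A} {P L X : A}
    (hLP : Submodule.span K {L} * Submodule.span K {P} ≤ Submodule.span K {P} * V)
    (hX : Submodule.span K {X} * (Submodule.span K {P} ⊔ Submodule.span K {L}) ≤
      (Submodule.span K {P} ⊔ Submodule.span K {L}) * V)
    (hpt : ∀ n, QuotBound (Submodule.span K {P} ⊔ Submodule.span K {L} ⊔ Submodule.span K {X})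
      V n 1) (n : ℕ) :
    QuotBound (Submodule.span K {P}) V n ((n + 2).choose 2) ∧ QuotBound ⊥ V n ((n + 3).choose 3) := by
  have h2 : ∀ n, QuotBound (Submodule.span K {P} ⊔ Submodule.span K {L}) V n (n + 1) := by
    intro n
    induction n with
    | zero => exact QuotBound.zero _ _ le_rfl
    | succ n ih => simpa only [add_comm 1] using QuotBound.step hX (hpt (n + 1)) ih
  have h1 : ∀ n, QuotBound (Submodule.span K {P}) V n ((n + 2).choose 2) := by
    intro n
    induction n with
    | zero => exact QuotBound.zero _ _ le_rfl
    | succ n ih =>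
      have := QuotBound.step hLP (h2 (n + 1)) ih
      rwa [show (n + 1 + 2).choose 2 = n + 1 + 1 + (n + 2).choose 2 by
        rw [Nat.choose_succ_succ' (n + 2) 1, Nat.choose_one_right]]
  refine ⟨h1 n, ?_⟩
  induction n with
  | zero => exact QuotBound.zero _ _ le_rfl
  | succ n ih =>
    have := QuotBound.step (W := ⊥) (U := ⊥) (l := P) (V := V) (by simp)
      (by rw [bot_sup_eq]; exact h1 (n + 1)) ih
    rwa [show (n + 1 + 3).choose 3 = (n + 1 + 2).choose 2 + (n + 3).choose 3 by
        rw [Nat.choose_succ_succ' (n + 3) 2]]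

end Bounds

section Points
variable {K A : Type*} [Field K] [Ring A] [Algebra K A] {ι : Type*} [Fintype ι]

/-- The vectors orthogonal to `p` for the standard bilinear form. -/
def perp (p : ι → K) : Submodule K (ι → K) := LinearMap.ker (Fintype.linearCombination K p)

theorem mem_perp {p m : ι → K} : m ∈ perp p ↔ ∑ i, m i * p i = 0 := by
  simp [perp, Fintype.linearCombination_apply]

/-- The linear forms in `x` that vanish at the point `p`. -/
def formsAt (x : ι → A) (p : ι → K) : Submodule K A :=
  (perp p).map (Fintype.linearCombination K x)

/-- If a zero of the multilinearised quadratic relations of `x` is determined up to a scalar by its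
first component, then truncated point modules have length one in each degree. -/
theorem quotBound_formsAt (x : ι → A)
    (h : ∀ p q r : ι → K, p ≠ 0 → q ≠ 0 →
      (∀ ρ : ι → ι → K, ∑ i, ∑ j, ρ i j • (x i * x j) = 0 →
        ∑ i, ∑ j, ρ i j * p i * q j = 0 ∧ ∑ i, ∑ j, ρ i j * p i * r j = 0) → ∃ t : K, r = t • q)
    (n : ℕ) (p : ι → K) (hp : p ≠ 0) :
    QuotBound (formsAt x p) (Submodule.span K (Set.range x)) n 1 := by
  classical
  induction n generalizing p with
  | zero => exact QuotBound.zero _ _ le_rfl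
  | succ n ih =>
    obtain ⟨i₀, hi₀⟩ := Function.ne_iff.1 hp
    set f : A := (p i₀)⁻¹ • x i₀ with hf
    have hsub : ∀ i, x i - p i • f ∈ formsAt x p := by
      intro i
      refine ⟨Pi.single i 1 - Pi.single i₀ (p i * (p i₀)⁻¹), ?_, ?_⟩
      · rw [SetLike.mem_coe, mem_perp]
        simp only [Pi.sub_apply, sub_mul, Finset.sum_sub_distrib, Pi.single_apply, ite_mul, one_mul,
          zero_mul, Finset.sum_ite_eq', Finset.mem_univ, if_true]
        have : p i₀ ≠ 0 := hi₀
        field_simp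
        ring
      · rw [map_sub, Fintype.linearCombination_apply_single, Fintype.linearCombination_apply_single,
          one_smul, hf, smul_smul]
    have hx : ∀ i, x i ∈ Submodule.span K (Set.range x) := fun i => Submodule.subset_span ⟨i, rfl⟩
    -- linear forms `m` with `f * m` in the right ideal
    let E : Submodule K (ι → K) :=
      (formsAt x p * Submodule.span K (Set.range x)).comap
        (LinearMap.mulLeft K f ∘ₗ Fintype.linearCombination K x)
    have hK : ∀ ρ : ι → ι → K, ∑ i, ∑ j, ρ i j • (x i * x j) = 0 →
        (fun j => ∑ i, ρ i j * p i) ∈ E := by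
      intro ρ hρ
      have e : f * Fintype.linearCombination K x (fun j => ∑ i, ρ i j * p i) =
          - ∑ i, ∑ j, ρ i j • ((x i - p i • f) * x j) := by
        rw [← sub_eq_zero, sub_neg_eq_add, ← hρ, Fintype.linearCombination_apply, Finset.mul_sum,
          Finset.sum_comm (f := fun i j => ρ i j • ((x i - p i • f) * x j)),
          Finset.sum_comm (f := fun i j => ρ i j • (x i * x j)), ← Finset.sum_add_distrib]
        refine Finset.sum_congr rfl fun j _ => ?_
        rw [Finset.sum_smul, Finset.mul_sum, ← Finset.sum_add_distrib]
        refine Finset.sum_congr rfl fun i _ => ?_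
        simp only [sub_mul, smul_sub, mul_smul_comm, smul_mul_assoc, smul_smul]
        abel
      rw [Submodule.mem_comap, LinearMap.comp_apply, LinearMap.mulLeft_apply]
      rw [e]
      exact Submodule.neg_mem _ (Submodule.sum_mem _ fun i _ => Submodule.sum_mem _ fun j _ => Submodule.smul_mem _ _
        (Submodule.mul_mem_mul (hsub i) (hx j)))
    have key : ∀ q : ι → K, (∀ r : ι → K, E ≤ perp r → ∃ t : K, r = t • q) → perp q ≤ E := by
      intro q hr m hm
      by_contra hmK
      obtain ⟨g, hgm, hg⟩ := Submodule.exists_le_ker_of_notMem hmK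
      have hg' : ∀ m, g m = ∑ i, m i * g fun j => if i = j then 1 else 0 :=
        LinearMap.pi_apply_eq_sum_univ g
      obtain ⟨t, ht⟩ := hr (fun i => g fun j => if i = j then 1 else 0) fun m' hm' => by
        rw [mem_perp, ← hg']
        exact hg hm'
      refine hgm ?_
      have : ∀ i, (g fun j => if i = j then 1 else 0) = t * q i := congrFun ht
      simp_rw [hg' m, this, mul_left_comm _ t, ← Finset.mul_sum, mem_perp.1 hm, mul_zero]
    have hrow : ∀ q : ι → K, E ≤ perp q → ∀ ρ : ι → ι → K, ∑ i, ∑ j, ρ i j • (x i * x j) = 0 →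
        ∑ i, ∑ j, ρ i j * p i * q j = 0 := by
      intro q hq ρ hρ
      have := mem_perp.1 (hq (hK ρ hρ))
      simp_rw [Finset.sum_mul] at this
      rwa [Finset.sum_comm]
    obtain ⟨q, hq, hqE⟩ : ∃ q : ι → K, q ≠ 0 ∧ perp q ≤ E := by
      by_cases hex : ∃ q : ι → K, q ≠ 0 ∧ E ≤ perp q
      · obtain ⟨q, hq, hEq⟩ := hex
        exact ⟨q, hq, key q fun r hr => h p q r hp hq fun ρ hρ => ⟨hrow q hEq ρ hρ, hrow r hr ρ hρ⟩⟩
      · push Not at hex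
        refine ⟨p, hp, key p fun r hr => ⟨0, ?_⟩⟩
        by_contra hr0
        rw [zero_smul] at hr0
        exact hex r hr0 hr
    have := QuotBound.step (W := formsAt x p) (U := formsAt x q) (l := f)
      (V := Submodule.span K (Set.range x)) (n := n) (d := 0) (e := 1) ?_ ?_ (ih q hq)
    · simpa using this
    · refine Submodule.mul_le.2 ?_
      intro y hy z hz
      obtain ⟨t, rfl⟩ := Submodule.mem_span_singleton.1 hy
      obtain ⟨m, hm, rfl⟩ := hz
      rw [smul_mul_assoc]
      exact Submodule.smul_mem _ _ (hqE hm)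
    · refine ⟨∅, le_rfl, ?_⟩
      simp only [rightIdealPart, Finset.coe_empty, Submodule.span_empty, sup_bot_eq, pow_succ']
      refine mul_le_mul' (Submodule.span_le.2 ?_) le_rfl
      rintro _ ⟨i, rfl⟩
      rw [← sub_add_cancel (x i) (p i • f)]
      exact Submodule.add_mem_sup (hsub i)
        (Submodule.smul_mem _ _ (Submodule.mem_span_singleton_self f))

end Points

section Incidence
variable {K : Type*} [Field K]

/-- The multilinearised relations of a four-dimensional Sklyanin algebra. -/
structure Incident (a b c p₀ p₁ p₂ p₃ q₀ q₁ q₂ q₃ : K) : Prop where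
  r01 : (b + c) * p₀ * q₁ = b * p₂ * q₃ - c * p₃ * q₂
  r10 : (b + c) * p₁ * q₀ = c * p₂ * q₃ - b * p₃ * q₂
  r02 : (c + a) * p₀ * q₂ = c * p₃ * q₁ - a * p₁ * q₃
  r20 : (c + a) * p₂ * q₀ = a * p₃ * q₁ - c * p₁ * q₃
  r03 : (a + b) * p₀ * q₃ = a * p₁ * q₂ - b * p₂ * q₁
  r30 : (a + b) * p₃ * q₀ = b * p₁ * q₂ - a * p₂ * q₁

variable {a b c p₀ p₁ p₂ p₃ q₀ q₁ q₂ q₃ r₀ r₁ r₂ r₃ : K}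

theorem Incident.rotate (h : Incident a b c p₀ p₁ p₂ p₃ q₀ q₁ q₂ q₃) :
    Incident b c a p₀ p₂ p₃ p₁ q₀ q₂ q₃ q₁ :=
  ⟨h.r02, h.r20, h.r03, h.r30, h.r01, h.r10⟩

theorem Incident.sub (hq : Incident a b c p₀ p₁ p₂ p₃ q₀ q₁ q₂ q₃)
    (hr : Incident a b c p₀ p₁ p₂ p₃ r₀ r₁ r₂ r₃) (s t : K) :
    Incident a b c p₀ p₁ p₂ p₃ (s * q₀ - t * r₀) (s * q₁ - t * r₁) (s * q₂ - t * r₂) (s * q₃ - t * r₃) where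
  r01 := by linear_combination s * hq.r01 - t * hr.r01
  r10 := by linear_combination s * hq.r10 - t * hr.r10
  r02 := by linear_combination s * hq.r02 - t * hr.r02
  r20 := by linear_combination s * hq.r20 - t * hr.r20
  r03 := by linear_combination s * hq.r03 - t * hr.r03
  r30 := by linear_combination s * hq.r30 - t * hr.r30

theorem Incident.parallel (hb : b ≠ 0) (hc : c ≠ 0) (hp : p₁ ≠ 0)
    (hq : Incident a b c p₀ p₁ p₂ p₃ 0 q₁ q₂ q₃) :
    ∃ u, q₁ = u * (b * c * p₁) ∧ q₂ = u * (c * a * p₂) ∧ q₃ = u * (a * b * p₃) := by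
  refine ⟨q₁ / (b * c * p₁), by field_simp, ?_, ?_⟩
  · field_simp
    linear_combination -hq.r30
  · field_simp
    linear_combination hq.r20

theorem Incident.mul_eq_of_parallel (hbc : b + c ≠ 0) {u : K} (hu : u ≠ 0) (hr₀ : r₀ ≠ 0)
    (hq : Incident a b c p₀ p₁ p₂ p₃ 0 (u * (b * c * p₁)) (u * (c * a * p₂)) (u * (a * b * p₃)))
    (hr : Incident a b c p₀ p₁ p₂ p₃ r₀ r₁ r₂ r₃) :
    -c * p₀ * (a + b) * p₃ = a * b * p₁ * p₂ ∧ b * p₀ * (c + a) * p₂ = a * c * p₁ * p₃ := by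
  have h : b * c * p₀ * p₁ = a * (b - c) * p₂ * p₃ := by
    refine mul_left_cancel₀ (mul_ne_zero hu hbc) ?_
    linear_combination hq.r01
  have e₁ : (b + c) * (c * p₀ * r₁ - b * p₁ * r₀) = (b + c) * ((b - c) * p₃ * r₂) := by
    linear_combination c * hr.r01 - b * hr.r10
  have e₂ : (b + c) * (b * p₀ * r₁ - c * p₁ * r₀) = (b + c) * ((b - c) * p₂ * r₃) := by
    linear_combination b * hr.r01 - c * hr.r10
  replace e₁ := mul_left_cancel₀ hbc e₁
  replace e₂ := mul_left_cancel₀ hbc e₂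
  constructor
  · refine mul_left_cancel₀ hr₀ ?_
    linear_combination a * p₂ * e₁ - r₂ * h - c * p₀ * hr.r30
  · refine mul_left_cancel₀ hr₀ ?_
    linear_combination a * p₃ * e₂ - r₃ * h + b * p₀ * hr.r20

theorem Incident.eq_zero_of_parallel (ha : a ≠ 0) (hb : b ≠ 0) (hc : c ≠ 0)
    (hbc : b + c ≠ 0) (hca : c + a ≠ 0) (hab : a + b ≠ 0) (h2 : (2 : K) ≠ 0)
    {u : K} (hu : u ≠ 0) (hr₀ : r₀ ≠ 0) (hp : p₁ ≠ 0)
    (hq : Incident a b c p₀ p₁ p₂ p₃ 0 (u * (b * c * p₁)) (u * (c * a * p₂)) (u * (a * b * p₃)))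
    (hr : Incident a b c p₀ p₁ p₂ p₃ r₀ r₁ r₂ r₃) : False := by
  obtain ⟨e₁, e₂⟩ := hq.mul_eq_of_parallel hbc hu hr₀ hr
  obtain ⟨f₁, f₂⟩ := hq.rotate.mul_eq_of_parallel hca hu hr₀ hr.rotate
  obtain ⟨g₁, g₂⟩ := hq.rotate.rotate.mul_eq_of_parallel hab hu hr₀ hr.rotate.rotate
  have t₁ : p₀ * p₁ = 0 := by
    refine mul_left_cancel₀ (mul_ne_zero h2 (mul_ne_zero ha hbc)) ?_
    linear_combination g₂ - f₁
  have t₂ : p₀ * p₂ = 0 := by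
    refine mul_left_cancel₀ (mul_ne_zero h2 (mul_ne_zero hb hca)) ?_
    linear_combination e₂ - g₁
  have t₃ : p₀ * p₃ = 0 := by
    refine mul_left_cancel₀ (mul_ne_zero h2 (mul_ne_zero hc hab)) ?_
    linear_combination f₂ - e₁
  have hp₀ : p₀ = 0 := (mul_eq_zero.1 t₁).resolve_right hp
  subst hp₀
  have hp₂ : p₂ = 0 := by simpa [ha, hb, hp] using e₁.symm
  have hp₃ : p₃ = 0 := by simpa [ha, hc, hp] using e₂.symm
  subst hp₂ hp₃
  simpa [hbc, hp, hr₀] using hr.r10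

theorem Incident.eq_zero_of_generic_of_ne_zero (ha : a ≠ 0) (hb : b ≠ 0) (hc : c ≠ 0)
    (hbc : b + c ≠ 0) (hca : c + a ≠ 0) (hab : a + b ≠ 0) (h2 : (2 : K) ≠ 0) (hp : p₁ ≠ 0)
    (hr₀ : r₀ ≠ 0) (hq : Incident a b c p₀ p₁ p₂ p₃ 0 q₁ q₂ q₃)
    (hr : Incident a b c p₀ p₁ p₂ p₃ r₀ r₁ r₂ r₃) : q₁ = 0 ∧ q₂ = 0 ∧ q₃ = 0 := by
  obtain ⟨u, rfl, rfl, rfl⟩ := hq.parallel hb hc hp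
  by_cases hu : u = 0
  · simp [hu]
  · exact (hq.eq_zero_of_parallel ha hb hc hbc hca hab h2 hu hr₀ hp hr).elim

theorem Incident.minors_of_generic_of_ne_zero (hb : b ≠ 0) (hc : c ≠ 0) (hp : p₁ ≠ 0)
    (hq : Incident a b c p₀ p₁ p₂ p₃ 0 q₁ q₂ q₃) (hr : Incident a b c p₀ p₁ p₂ p₃ 0 r₁ r₂ r₃) :
    q₁ * r₂ = q₂ * r₁ ∧ q₂ * r₃ = q₃ * r₂ ∧ q₃ * r₁ = q₁ * r₃ := by
  obtain ⟨u, rfl, rfl, rfl⟩ := hq.parallel hb hc hp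
  obtain ⟨v, rfl, rfl, rfl⟩ := hr.parallel hb hc hp
  refine ⟨?_, ?_, ?_⟩ <;> ring

theorem Incident.eq_zero_of_vertex (hbc : b + c ≠ 0) (hca : c + a ≠ 0) (hab : a + b ≠ 0)
    (hp : p₀ ≠ 0) (hq : Incident a b c p₀ 0 0 0 q₀ q₁ q₂ q₃) : q₁ = 0 ∧ q₂ = 0 ∧ q₃ = 0 :=
  ⟨by simpa [hbc, hp] using hq.r01, by simpa [hca, hp] using hq.r02,
    by simpa [hab, hp] using hq.r03⟩

theorem Incident.eq_zero_of_degenerate (hb : b ≠ 0) (hc : c ≠ 0) (hbc : b + c ≠ 0)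
    (hp : p₁ ≠ 0 ∨ p₂ ≠ 0 ∨ p₃ ≠ 0)
    (hr₀ : r₀ ≠ 0) (hq : Incident 0 b c p₀ p₁ p₂ p₃ 0 q₁ q₂ q₃)
    (hr : Incident 0 b c p₀ p₁ p₂ p₃ r₀ r₁ r₂ r₃) : q₁ = 0 ∧ q₂ = 0 ∧ q₃ = 0 := by
  obtain ⟨h4, h1, h5, h2, h6, h3⟩ := hq
  obtain ⟨g4, g1, g5, g2, g6, g3⟩ := hr
  simp only [add_zero, zero_add, zero_mul, sub_zero, zero_sub, mul_zero] at *
  grind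

theorem Incident.degenerate (hb : b ≠ 0) (hc : c ≠ 0)
    (hq : Incident 0 b c p₀ p₁ p₂ p₃ 0 q₁ q₂ q₃) :
    p₀ * q₂ = p₃ * q₁ ∧ p₁ * q₃ = 0 ∧ p₀ * q₃ = -(p₂ * q₁) ∧ p₁ * q₂ = 0 := by
  refine ⟨mul_left_cancel₀ hc ?_, mul_left_cancel₀ hc ?_, mul_left_cancel₀ hb ?_,
    mul_left_cancel₀ hb ?_⟩
  · linear_combination hq.r02
  · linear_combination hq.r20
  · linear_combination hq.r03
  · linear_combination -hq.r30

theorem Incident.minors_of_degenerate (hb : b ≠ 0) (hc : c ≠ 0)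
    (hp : p₁ ≠ 0 ∨ p₂ ≠ 0 ∨ p₃ ≠ 0)
    (hq : Incident 0 b c p₀ p₁ p₂ p₃ 0 q₁ q₂ q₃)
    (hr : Incident 0 b c p₀ p₁ p₂ p₃ 0 r₁ r₂ r₃) :
    q₁ * r₂ = q₂ * r₁ ∧ q₂ * r₃ = q₃ * r₂ ∧ q₃ * r₁ = q₁ * r₃ := by
  obtain ⟨e₁, e₂, e₃, e₄⟩ := hq.degenerate hb hc
  obtain ⟨f₁, f₂, f₃, f₄⟩ := hr.degenerate hb hc
  have hq1 := hq.r10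
  have hr1 := hr.r10
  by_cases hp₁ : p₁ = 0
  · subst hp₁
    have h₂₃ : q₂ * r₃ = q₃ * r₂ := by
      rcases hp.resolve_left (not_not.2 rfl) with hp | hp
      · refine mul_left_cancel₀ (mul_ne_zero hc hp) ?_
        linear_combination r₂ * hq1 - q₂ * hr1
      · refine mul_left_cancel₀ (mul_ne_zero hb hp) ?_
        linear_combination r₃ * hq1 - q₃ * hr1
    by_cases hp₀ : p₀ = 0
    · subst hp₀
      have hq₁ : q₁ = 0 := by grind
      have hr₁ : r₁ = 0 := by grind
      simp [hq₁, hr₁, h₂₃]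
    · refine ⟨mul_left_cancel₀ hp₀ ?_, h₂₃, mul_left_cancel₀ hp₀ ?_⟩
      · linear_combination q₁ * f₁ - r₁ * e₁
      · linear_combination r₁ * e₃ - q₁ * f₃
  · have hq₂ : q₂ = 0 := by simpa [hp₁] using e₄
    have hq₃ : q₃ = 0 := by simpa [hp₁] using e₂
    have hr₂ : r₂ = 0 := by simpa [hp₁] using f₄
    have hr₃ : r₃ = 0 := by simpa [hp₁] using f₂
    simp [hq₂, hq₃, hr₂, hr₃]

/-- Nonvanishing of the pairwise sums of three parameters; then at most one of them is zero. -/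
structure Admissible (a b c : K) : Prop where
  hbc : b + c ≠ 0
  hca : c + a ≠ 0
  hab : a + b ≠ 0

theorem Admissible.rotate (h : Admissible a b c) : Admissible b c a := ⟨h.hca, h.hab, h.hbc⟩

theorem Admissible.cases (h : Admissible a b c) :
    (a ≠ 0 ∧ b ≠ 0 ∧ c ≠ 0) ∨ (a = 0 ∧ b ≠ 0 ∧ c ≠ 0) ∨ (b = 0 ∧ c ≠ 0 ∧ a ≠ 0) ∨
      (c = 0 ∧ a ≠ 0 ∧ b ≠ 0) := by
  obtain ⟨h₁, h₂, h₃⟩ := h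
  grind

theorem Incident.eq_zero (h : Admissible a b c) (h2 : (2 : K) ≠ 0)
    (hp : p₁ ≠ 0 ∨ p₂ ≠ 0 ∨ p₃ ≠ 0) (hr₀ : r₀ ≠ 0)
    (hq : Incident a b c p₀ p₁ p₂ p₃ 0 q₁ q₂ q₃)
    (hr : Incident a b c p₀ p₁ p₂ p₃ r₀ r₁ r₂ r₃) : q₁ = 0 ∧ q₂ = 0 ∧ q₃ = 0 := by
  obtain ⟨hbc, hca, hab⟩ := id h
  rcases h.cases with ⟨ha, hb, hc⟩ | ⟨rfl, hb, hc⟩ | ⟨rfl, hc, ha⟩ | ⟨rfl, ha, hb⟩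
  · rcases hp with hp | hp | hp
    · exact hq.eq_zero_of_generic_of_ne_zero ha hb hc hbc hca hab h2 hp hr₀ hr
    · have := hq.rotate.eq_zero_of_generic_of_ne_zero hb hc ha hca hab hbc h2 hp hr₀ hr.rotate
      tauto
    · have := hq.rotate.rotate.eq_zero_of_generic_of_ne_zero hc ha hb hab hbc hca h2 hp hr₀
        hr.rotate.rotate
      tauto
  · exact hq.eq_zero_of_degenerate hb hc hbc hp hr₀ hr
  · have := hq.rotate.eq_zero_of_degenerate hc ha hca (by tauto) hr₀ hr.rotate
    tauto
  · have := hq.rotate.rotate.eq_zero_of_degenerate ha hb hab (by tauto) hr₀ hr.rotate.rotate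
    tauto

theorem Incident.minors (h : Admissible a b c) (hp : p₁ ≠ 0 ∨ p₂ ≠ 0 ∨ p₃ ≠ 0)
    (hq : Incident a b c p₀ p₁ p₂ p₃ 0 q₁ q₂ q₃) (hr : Incident a b c p₀ p₁ p₂ p₃ 0 r₁ r₂ r₃) :
    q₁ * r₂ = q₂ * r₁ ∧ q₂ * r₃ = q₃ * r₂ ∧ q₃ * r₁ = q₁ * r₃ := by
  rcases h.cases with ⟨ha, hb, hc⟩ | ⟨rfl, hb, hc⟩ | ⟨rfl, hc, ha⟩ | ⟨rfl, ha, hb⟩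
  · rcases hp with hp | hp | hp
    · exact hq.minors_of_generic_of_ne_zero hb hc hp hr
    · have := hq.rotate.minors_of_generic_of_ne_zero hc ha hp hr.rotate
      tauto
    · have := hq.rotate.rotate.minors_of_generic_of_ne_zero ha hb hp hr.rotate.rotate
      tauto
  · exact hq.minors_of_degenerate hb hc hp hr
  · have := hq.rotate.minors_of_degenerate hc ha (by tauto) hr.rotate
    tauto
  · have := hq.rotate.rotate.minors_of_degenerate ha hb (by tauto) hr.rotate.rotate
    tauto

/-- For admissible parameters the second component of an incident pair is determined by the first
one up to a scalar. -/
theorem Incident.exists_smul (h : Admissible a b c) (h2 : (2 : K) ≠ 0)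
    (hp : p₀ ≠ 0 ∨ p₁ ≠ 0 ∨ p₂ ≠ 0 ∨ p₃ ≠ 0) (hq₀ : q₀ ≠ 0 ∨ q₁ ≠ 0 ∨ q₂ ≠ 0 ∨ q₃ ≠ 0)
    (hq : Incident a b c p₀ p₁ p₂ p₃ q₀ q₁ q₂ q₃) (hr : Incident a b c p₀ p₁ p₂ p₃ r₀ r₁ r₂ r₃) :
    ∃ t, r₀ = t * q₀ ∧ r₁ = t * q₁ ∧ r₂ = t * q₂ ∧ r₃ = t * q₃ := by
  by_cases hp' : p₁ = 0 ∧ p₂ = 0 ∧ p₃ = 0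
  · obtain ⟨rfl, rfl, rfl⟩ := hp'
    have hp₀ : p₀ ≠ 0 := by tauto
    obtain ⟨rfl, rfl, rfl⟩ := hq.eq_zero_of_vertex h.hbc h.hca h.hab hp₀
    obtain ⟨rfl, rfl, rfl⟩ := hr.eq_zero_of_vertex h.hbc h.hca h.hab hp₀
    have : q₀ ≠ 0 := by tauto
    exact ⟨r₀ / q₀, by field_simp, by simp⟩
  replace hp' : p₁ ≠ 0 ∨ p₂ ≠ 0 ∨ p₃ ≠ 0 := by tauto
  by_cases h₀ : q₀ = 0
  · subst h₀
    by_cases h₀' : r₀ = 0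
    · subst h₀'
      obtain ⟨m₁, m₂, m₃⟩ := Incident.minors h hp' hq hr
      rcases hq₀.resolve_left (not_not.2 rfl) with h | h | h
      · exact ⟨r₁ / q₁, by simp, by field_simp, by field_simp; linear_combination m₁,
          by field_simp; linear_combination -m₃⟩
      · exact ⟨r₂ / q₂, by simp, by field_simp; linear_combination -m₁, by field_simp,
          by field_simp; linear_combination m₂⟩
      · exact ⟨r₃ / q₃, by simp, by field_simp; linear_combination m₃,
          by field_simp; linear_combination -m₂, by field_simp⟩
    · exact absurd (Incident.eq_zero h h2 hp' h₀' hq hr) (by tauto)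
  · have hs := hr.sub hq q₀ r₀
    rw [show q₀ * r₀ - r₀ * q₀ = 0 by ring] at hs
    obtain ⟨e₁, e₂, e₃⟩ := Incident.eq_zero h h2 hp' h₀ hs hq
    refine ⟨r₀ / q₀, ?_, ?_, ?_, ?_⟩ <;> field_simp
    · linear_combination e₁
    · linear_combination e₂
    · linear_combination e₃

end Incidence

section Flags
variable {K A : Type*} [Field K] [Ring A] [Algebra K A]

/-- The relations of a four-dimensional Sklyanin algebra in symmetric parameters. -/
structure SkRel (a b c : K) (x : Fin 4 → A) : Prop where
  r01 : (b + c) • (x 0 * x 1) = b • (x 2 * x 3) - c • (x 3 * x 2)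
  r10 : (b + c) • (x 1 * x 0) = c • (x 2 * x 3) - b • (x 3 * x 2)
  r02 : (c + a) • (x 0 * x 2) = c • (x 3 * x 1) - a • (x 1 * x 3)
  r20 : (c + a) • (x 2 * x 0) = a • (x 3 * x 1) - c • (x 1 * x 3)
  r03 : (a + b) • (x 0 * x 3) = a • (x 1 * x 2) - b • (x 2 * x 1)
  r30 : (a + b) • (x 3 * x 0) = b • (x 1 * x 2) - a • (x 2 * x 1)

variable {a b c : K} {x : Fin 4 → A}

theorem SkRel.rotate (h : SkRel a b c x) : SkRel b c a ![x 0, x 2, x 3, x 1] :=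
  ⟨h.r02, h.r20, h.r03, h.r30, h.r01, h.r10⟩

theorem range_rotate {B : Type*} (x : Fin 4 → B) : Set.range ![x 0, x 2, x 3, x 1] = Set.range x := by
  ext y
  simp only [Set.mem_range, Fin.exists_fin_succ]
  simp
  tauto

theorem SkRel.quotBound_formsAt (h : SkRel a b c x) (hadm : Admissible a b c) (h2 : (2 : K) ≠ 0)
    (p : Fin 4 → K) (hp : p ≠ 0) (n : ℕ) :
    QuotBound (formsAt x p) (Submodule.span K (Set.range x)) n 1 := by
  refine _root_.quotBound_formsAt x (fun p q r hp hq H => ?_) n p hp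
  have hne : ∀ p : Fin 4 → K, p ≠ 0 → p 0 ≠ 0 ∨ p 1 ≠ 0 ∨ p 2 ≠ 0 ∨ p 3 ≠ 0 := by
    intro p hp
    obtain ⟨i, hi⟩ := Function.ne_iff.1 hp
    fin_cases i <;> simp_all
  have h01 := H ![![0, b + c, 0, 0], 0, ![0, 0, 0, -b], ![0, 0, c, 0]] (by
    simp [Fin.sum_univ_four, h.r01]
    abel)
  have h10 := H ![0, ![b + c, 0, 0, 0], ![0, 0, 0, -c], ![0, 0, b, 0]] (by
    simp [Fin.sum_univ_four, h.r10]
    abel)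
  have h02 := H ![![0, 0, c + a, 0], ![0, 0, 0, a], 0, ![0, -c, 0, 0]] (by
    simp [Fin.sum_univ_four, h.r02])
  have h20 := H ![0, ![0, 0, 0, c], ![c + a, 0, 0, 0], ![0, -a, 0, 0]] (by
    simp [Fin.sum_univ_four, h.r20])
  have h03 := H ![![0, 0, 0, a + b], ![0, 0, -a, 0], ![0, b, 0, 0], 0] (by
    simp [Fin.sum_univ_four, h.r03]
    abel)
  have h30 := H ![0, ![0, 0, -b, 0], ![0, a, 0, 0], ![a + b, 0, 0, 0]] (by
    simp [Fin.sum_univ_four, h.r30])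
  simp [Fin.sum_univ_four] at h01 h10 h02 h20 h03 h30
  obtain ⟨t, h₀, h₁, h₂, h₃⟩ := Incident.exists_smul (a := a) (b := b) (c := c) hadm h2 (hne p hp)
    (hne q hq) (r₀ := r 0) (r₁ := r 1) (r₂ := r 2) (r₃ := r 3)
    ⟨by linear_combination h01.1, by linear_combination h10.1, by linear_combination h02.1,
      by linear_combination h20.1, by linear_combination h03.1, by linear_combination h30.1⟩
    ⟨by linear_combination h01.2, by linear_combination h10.2, by linear_combination h02.2,
      by linear_combination h20.2, by linear_combination h03.2, by linear_combination h30.2⟩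
  refine ⟨t, ?_⟩
  ext i
  fin_cases i <;> assumption

theorem QuotBound.mono {W W' V : Submodule K A} (hW : W ≤ W') {n d : ℕ} (h : QuotBound W V n d) :
    QuotBound W' V n d := by
  obtain ⟨s, hs, hs'⟩ := h
  refine ⟨s, hs, hs'.trans (sup_le_sup ?_ le_rfl)⟩
  cases n with
  | zero => exact le_rfl
  | succ n => exact mul_le_mul' hW le_rfl

theorem SkRel.anticomm₁ (h : SkRel a b c x) (hbc : b + c ≠ 0) :
    x 0 * x 1 + x 1 * x 0 = x 2 * x 3 - x 3 * x 2 := by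
  refine smul_right_injective A hbc ?_
  simp only [smul_add, h.r01, h.r10]
  module

theorem SkRel.anticomm₂ (h : SkRel a b c x) (hca : c + a ≠ 0) :
    x 0 * x 2 + x 2 * x 0 = x 3 * x 1 - x 1 * x 3 := h.rotate.anticomm₁ hca

theorem SkRel.anticomm₃ (h : SkRel a b c x) (hab : a + b ≠ 0) :
    x 0 * x 3 + x 3 * x 0 = x 1 * x 2 - x 2 * x 1 := h.rotate.rotate.anticomm₁ hab

theorem SkRel.flag_LP (h : SkRel a b c x) (hadm : Admissible a b c) {y v t : K}
    (hy : y ^ 2 = c - b) (hv : v ^ 2 = a - c) (ht : t ^ 2 = b - a) :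
    (y • x 0 + t • x 2 - v • x 3) * (y • x 1 + v • x 2 + t • x 3) =
      (y • x 1 + v • x 2 + t • x 3) * (-y • x 0 + t • x 2 - v • x 3) := by
  have e : t ^ 2 = - y ^ 2 - v ^ 2 := by rw [hy, hv, ht]; ring
  have e₁ := h.anticomm₁ hadm.hbc
  have e₂ := h.anticomm₂ hadm.hca
  have e₃ := h.anticomm₃ hadm.hab
  simp only [mul_add, add_mul, mul_sub, sub_mul, smul_mul_assoc, mul_smul_comm]
  linear_combination (norm := skip) (y ^ 2) • e₁ + (y * v) • e₂ + (y * t) • e₃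
  match_scalars <;> grind

theorem SkRel.flag_XP (h : SkRel a b c x) {y v t : K}
    (hy : y ^ 2 = c - b) (hv : v ^ 2 = a - c) (ht : t ^ 2 = b - a) :
    y • (((v * t) • x 1 - a • x 0) * (y • x 1 + v • x 2 + t • x 3)) =
      (t • x 0 + v • x 1 - y • x 2) * (-b • (t • x 1 - y • x 3)) +
      (v • x 0 - t • x 1 + y • x 3) * (c • (y • x 2 - v • x 1)) := by
  simp only [mul_add, add_mul, mul_sub, sub_mul, smul_mul_assoc, mul_smul_comm, smul_smul, smul_sub, smul_add]
  linear_combination (norm := skip) (-y ^ 2) • h.r01 - (y * v) • h.r02 - (y * t) • h.r03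
  match_scalars <;> grind

theorem SkRel.flag_XQ (h : SkRel a b c x) {y v t : K}
    (hy : y ^ 2 = c - b) (hv : v ^ 2 = a - c) (ht : t ^ 2 = b - a) :
    y • (((v * t) • x 1 - a • x 0) *
        ((y * v * t) • x 0 + (a * y) • x 1 + (b * v) • x 2 + (c * t) • x 3)) =
      (t • x 0 + v • x 1 - y • x 2) * ((b * (c + a) * v) • x 0 + (a * c * t) • x 1 - (a * c * y) • x 3) -
      (v • x 0 - t • x 1 + y • x 3) * ((c * (a + b) * t) • x 0 + (a * b * y) • x 2 - (a * b * v) • x 1) := by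
  simp only [mul_add, add_mul, mul_sub, sub_mul, smul_mul_assoc, mul_smul_comm, smul_smul, smul_sub, smul_add]
  linear_combination (norm := skip) (a * y ^ 2) • h.r10 + (y * b * v) • h.r20 + (y * c * t) • h.r30
  match_scalars <;> grind

end Flags

section FlagCases
variable {K A : Type*} [Field K] [Ring A] [Algebra K A] {a b c : K} {x : Fin 4 → A}

theorem mem_span_gens (x : Fin 4 → A) (i : Fin 4) : x i ∈ Submodule.span K (Set.range x) :=
  Submodule.subset_span ⟨i, rfl⟩

theorem span_singleton_mul_sup_le {W : Submodule K A} {X P L : A} (hP : X * P ∈ W) (hL : X * L ∈ W) :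
    Submodule.span K {X} * (Submodule.span K {P} ⊔ Submodule.span K {L}) ≤ W := by
  rw [Submodule.mul_sup, Submodule.span_mul_span, Submodule.span_mul_span, Set.singleton_mul_singleton,
    Set.singleton_mul_singleton]
  exact sup_le ((Submodule.span_singleton_le_iff_mem _ _).2 hP)
    ((Submodule.span_singleton_le_iff_mem _ _).2 hL)

/-- The bounds on the quotients `A / P A` and `A` produced by a flag starting with `P`. -/
def FlagBound (x : Fin 4 → A) (P : A) : Prop :=
  ∀ n, QuotBound (Submodule.span K {P}) (Submodule.span K (Set.range x)) n ((n + 2).choose 2) ∧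
    QuotBound ⊥ (Submodule.span K (Set.range x)) n ((n + 3).choose 3)

theorem SkRel.flagBound_of_distinct (h : SkRel a b c x) (hadm : Admissible a b c) (h2 : (2 : K) ≠ 0)
    {y v t : K} (hy : y ^ 2 = c - b) (hv : v ^ 2 = a - c) (ht : t ^ 2 = b - a)
    (hy₀ : y ≠ 0) (hv₀ : v ≠ 0) (ht₀ : t ≠ 0) :
    FlagBound (K := K) x (y • x 1 + v • x 2 + t • x 3) := by
  set V := Submodule.span K (Set.range x) with hV
  set P := y • x 1 + v • x 2 + t • x 3 with hP
  set L := y • x 0 + t • x 2 - v • x 3 with hL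
  set X := (v * t) • x 1 - a • x 0 with hX
  set W := Submodule.span K {P} ⊔ Submodule.span K {L} with hW
  have hPW : P ∈ W := Submodule.mem_sup_left (Submodule.mem_span_singleton_self P)
  have hLW : L ∈ W := Submodule.mem_sup_right (Submodule.mem_span_singleton_self L)
  have hx : ∀ i, x i ∈ V := mem_span_gens x
  have e : t ^ 2 = - y ^ 2 - v ^ 2 := by rw [hy, hv, ht]; ring
  have h₃ : t • x 0 + v • x 1 - y • x 2 ∈ W := by
    rw [← Submodule.smul_mem_iff W hy₀, show y • (t • x 0 + v • x 1 - y • x 2) = t • L + v • P by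
      rw [hP, hL]
      match_scalars <;> grind]
    exact W.add_mem (W.smul_mem _ hLW) (W.smul_mem _ hPW)
  have h₂ : v • x 0 - t • x 1 + y • x 3 ∈ W := by
    rw [← Submodule.smul_mem_iff W hy₀, show y • (v • x 0 - t • x 1 + y • x 3) = v • L - t • P by
      rw [hP, hL]
      match_scalars <;> grind]
    exact W.sub_mem (W.smul_mem _ hLW) (W.smul_mem _ hPW)
  have hXP : X * P ∈ W * V := by
    rw [← Submodule.smul_mem_iff _ hy₀, h.flag_XP hy hv ht]
    refine add_mem (Submodule.mul_mem_mul h₃ (V.smul_mem _ (sub_mem ?_ ?_)))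
      (Submodule.mul_mem_mul h₂ (V.smul_mem _ (sub_mem ?_ ?_))) <;> exact V.smul_mem _ (hx _)
  have hXQ : X * ((y * v * t) • x 0 + (a * y) • x 1 + (b * v) • x 2 + (c * t) • x 3) ∈ W * V := by
    rw [← Submodule.smul_mem_iff _ hy₀, h.flag_XQ hy hv ht]
    refine sub_mem (Submodule.mul_mem_mul h₃ (sub_mem (add_mem ?_ ?_) ?_))
      (Submodule.mul_mem_mul h₂ (sub_mem (add_mem ?_ ?_) ?_)) <;> exact V.smul_mem _ (hx _)
  refine quotBound_of_flag (L := L) (X := X) ?_ (span_singleton_mul_sup_le hXP ?_) fun n =>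
    (h.quotBound_formsAt hadm h2 ![y * v * t, a * y, b * v, c * t]
      (fun h0 => mul_ne_zero (mul_ne_zero hy₀ hv₀) ht₀ (congrFun h0 0)) n).mono ?_
  · rw [Submodule.span_mul_span, Set.singleton_mul_singleton, Submodule.span_singleton_le_iff_mem,
      h.flag_LP hadm hy hv ht]
    refine Submodule.mul_mem_mul (Submodule.mem_span_singleton_self P)
      (sub_mem (add_mem ?_ ?_) ?_) <;> exact V.smul_mem _ (hx _)
  · rw [← Submodule.smul_mem_iff _ (mul_ne_zero hv₀ ht₀), ← mul_smul_comm,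
      show (v * t) • L = ((y * v * t) • x 0 + (a * y) • x 1 + (b * v) • x 2 + (c * t) • x 3) - a • P by
      rw [hP, hL]
      match_scalars <;> grind, mul_sub, mul_smul_comm]
    exact sub_mem hXQ (Submodule.smul_mem _ _ hXP)
  · rintro _ ⟨m, hm, rfl⟩
    rw [SetLike.mem_coe, mem_perp] at hm
    simp [Fin.sum_univ_four] at hm
    rw [← Submodule.smul_mem_iff _ (mul_ne_zero (pow_ne_zero 2 hy₀) (mul_ne_zero hv₀ ht₀)),
      show (y ^ 2 * (v * t)) • Fintype.linearCombination K x m =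
        ((-v * t * (v * m 2 + t * m 3)) • P + (-v * t * (t * m 2 - v * m 3)) • L) +
          (y ^ 2 * m 1 + y * (v * m 2 + t * m 3)) • X by
        rw [hP, hL, hX, Fintype.linearCombination_apply, Fin.sum_univ_four]
        match_scalars <;> grind]
    exact Submodule.add_mem_sup (W.add_mem (W.smul_mem _ hPW) (W.smul_mem _ hLW))
      (Submodule.smul_mem _ _ (Submodule.mem_span_singleton_self X))

theorem SkRel.flagBound_of_eq (h : SkRel a b b x) (hadm : Admissible a b b) (h2 : (2 : K) ≠ 0)
    {i : K} (hi : i ^ 2 = -1) : FlagBound (K := K) x (x 1) := by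
  set V := Submodule.span K (Set.range x) with hV
  set P := x 1 with hP
  set L := x 0 with hL
  set X := x 2 + i • x 3 with hX
  set W := Submodule.span K {P} ⊔ Submodule.span K {L} with hW
  have hPW : P ∈ W := Submodule.mem_sup_left (Submodule.mem_span_singleton_self P)
  have hLW : L ∈ W := Submodule.mem_sup_right (Submodule.mem_span_singleton_self L)
  have hx : ∀ i, x i ∈ V := mem_span_gens x
  have hXV : X ∈ V := V.add_mem (hx 2) (V.smul_mem i (hx 3))
  have hb : b ≠ 0 := fun h0 => hadm.hbc (by rw [h0, add_zero])
  have hab := hadm.hab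
  have hcomm : L * P = P * L := by
    refine smul_right_injective A hadm.hbc ?_
    simp only [hL, hP, h.r01, h.r10]
  have eL : (b * (a + b)) • (X * L) = (a + b) • (L * (a • X) - P * ((i * (a - b)) • X)) := by
    simp only [hX, hL, hP, mul_add, add_mul, smul_mul_assoc, mul_smul_comm, smul_add, smul_sub]
    linear_combination (norm := skip) b • h.r20 + (b * i) • h.r30 - a • h.r02 - (a * i) • h.r03
    match_scalars <;> grind
  have eP : (b * (a + b)) • (X * P) = (a + b) • (L * ((i * (a + b)) • X) + P * (a • X)) := by
    simp only [hX, hL, hP, mul_add, add_mul, smul_mul_assoc, mul_smul_comm, smul_add]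
    linear_combination (norm := skip) (- (i * (a + b))) • h.r02 + (a + b) • h.r03
    match_scalars <;> grind
  refine quotBound_of_flag (L := L) (X := X) ?_ (span_singleton_mul_sup_le ?_ ?_) fun n =>
    (h.quotBound_formsAt hadm h2 ![0, 0, i, -1] (fun h0 => by simpa using congrFun h0 3) n).mono ?_
  · rw [Submodule.span_mul_span, Set.singleton_mul_singleton, Submodule.span_singleton_le_iff_mem,
      hcomm]
    exact Submodule.mul_mem_mul (Submodule.mem_span_singleton_self P) (hx 0)
  · rw [← Submodule.smul_mem_iff _ (mul_ne_zero hb hab), eP]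
    exact Submodule.smul_mem _ _ (add_mem (Submodule.mul_mem_mul hLW (V.smul_mem _ hXV))
      (Submodule.mul_mem_mul hPW (V.smul_mem _ hXV)))
  · rw [← Submodule.smul_mem_iff _ (mul_ne_zero hb hab), eL]
    exact Submodule.smul_mem _ _ (sub_mem (Submodule.mul_mem_mul hLW (V.smul_mem _ hXV))
      (Submodule.mul_mem_mul hPW (V.smul_mem _ hXV)))
  · rintro _ ⟨m, hm, rfl⟩
    rw [SetLike.mem_coe, mem_perp] at hm
    simp [Fin.sum_univ_four] at hm
    rw [show Fintype.linearCombination K x m = (m 1 • P + m 0 • L) + m 2 • X by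
        rw [hP, hL, hX, Fintype.linearCombination_apply, Fin.sum_univ_four]
        match_scalars <;> grind]
    exact Submodule.add_mem_sup (W.add_mem (W.smul_mem _ hPW) (W.smul_mem _ hLW))
      (Submodule.smul_mem _ _ (Submodule.mem_span_singleton_self X))

theorem SkRel.exists_flagBound [IsAlgClosed K] (h : SkRel a b c x) (hadm : Admissible a b c)
    (h2 : (2 : K) ≠ 0) :
    ∃ P ∈ Submodule.span K {x 1, x 2, x 3}, FlagBound (K := K) x P := by
  have hroot : ∀ z : K, ∃ w, w ^ 2 = z := fun z => IsAlgClosed.exists_pow_nat_eq z two_pos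
  obtain ⟨i, hi⟩ := hroot (-1)
  have hmem : ∀ {j}, j = x 1 ∨ j = x 2 ∨ j = x 3 → j ∈ Submodule.span K {x 1, x 2, x 3} :=
    fun hj => Submodule.subset_span hj
  by_cases hbc : b = c
  · subst hbc
    exact ⟨_, hmem (.inl rfl), h.flagBound_of_eq hadm h2 hi⟩
  by_cases hca : c = a
  · subst hca
    have := h.rotate.flagBound_of_eq hadm.rotate h2 hi
    rw [FlagBound, range_rotate] at this
    exact ⟨_, hmem (.inr (.inl rfl)), this⟩
  by_cases hab : a = b
  · subst hab
    have := h.rotate.rotate.flagBound_of_eq hadm.rotate.rotate h2 hi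
    rw [FlagBound, range_rotate, range_rotate] at this
    exact ⟨_, hmem (.inr (.inr rfl)), this⟩
  obtain ⟨y, hy⟩ := hroot (c - b)
  obtain ⟨v, hv⟩ := hroot (a - c)
  obtain ⟨t, ht⟩ := hroot (b - a)
  refine ⟨_, add_mem (add_mem ?_ ?_) ?_, h.flagBound_of_distinct hadm h2 hy hv ht ?_ ?_ ?_⟩
  · exact Submodule.smul_mem _ _ (hmem (.inl rfl))
  · exact Submodule.smul_mem _ _ (hmem (.inr (.inl rfl)))
  · exact Submodule.smul_mem _ _ (hmem (.inr (.inr rfl)))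
  all_goals
    rintro rfl
    grind

end FlagCases

section Presentation
universe u
variable {K A : Type u} [Field K] [Ring A] [Algebra K A]

/-- `A` is generated by `x` subject exactly to the relations `SkRel a b c`. -/
structure IsSklyanin (a b c : K) (x : Fin 4 → A) : Prop extends SkRel a b c x where
  adjoin_eq : Algebra.adjoin K (Set.range x) = ⊤
  exists_lift : ∀ (B : Type u) [Ring B] [Algebra K B] (y : Fin 4 → B), SkRel a b c y →
    ∃ f : A →ₐ[K] B, ∀ i, f (x i) = y i

variable {a b c : K} {x : Fin 4 → A}

open Polynomial in
theorem IsSklyanin.exists_grading (h : IsSklyanin a b c x) :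
    ∃ pr : ℕ → A →ₗ[K] A, (∀ n, ∀ f ∈ Submodule.span K (Set.range x) ^ n, pr n f = f) ∧
      (∀ n f, pr n f ∈ Submodule.span K (Set.range x) ^ n) ∧
      (∀ i f, pr 0 (x i * f) = 0) ∧ ∀ n i f, pr (n + 1) (x i * f) = x i * pr n f := by
  set V := Submodule.span K (Set.range x) with hV
  obtain ⟨δ, hδ⟩ := h.exists_lift A[X] (fun i => monomial 1 (x i)) (by
    constructor <;> simp only [monomial_mul_monomial, smul_monomial, ← map_sub] <;> congr 1
    exacts [h.r01, h.r10, h.r02, h.r20, h.r03, h.r30])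
  have hδV : ∀ f ∈ V, δ f = monomial 1 f := by
    intro f hf
    induction hf using Submodule.span_induction with
    | mem f hf => obtain ⟨i, rfl⟩ := hf; exact hδ i
    | zero => simp
    | add f g _ _ hf hg => rw [map_add, hf, hg, map_add]
    | smul t f _ hf => rw [map_smul, hf, smul_monomial]
  refine ⟨fun n => (lcoeff A n).restrictScalars K ∘ₗ δ.toLinearMap, ?_, ?_, ?_, ?_⟩
  · intro n f hf
    suffices δ f = monomial n f by simp [this]
    induction n generalizing f with
    | zero =>
      rw [pow_zero, Submodule.mem_one] at hf
      obtain ⟨t, rfl⟩ := hf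
      rw [AlgHom.commutes]
      rfl
    | succ n ih =>
      rw [pow_succ'] at hf
      induction hf using Submodule.mul_induction_on' with
      | mem_mul_mem f hf g hg => rw [map_mul, hδV f hf, ih g hg, monomial_mul_monomial, add_comm]
      | add f _ g _ hf hg => rw [map_add, hf, hg, map_add]
  · intro n f
    have hf : f ∈ Algebra.adjoin K (Set.range x) := h.adjoin_eq ▸ trivial
    change (δ f).coeff n ∈ V ^ n
    induction hf using Algebra.adjoin_induction generalizing n with
    | mem f hf =>
      obtain ⟨i, rfl⟩ := hf
      rw [hδ, coeff_monomial]
      split_ifs with hn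
      · subst hn
        rw [pow_one]
        exact Submodule.subset_span ⟨i, rfl⟩
      · exact zero_mem _
    | algebraMap t =>
      rw [AlgHom.commutes, Polynomial.algebraMap_apply, coeff_C]
      split_ifs with hn
      · subst hn
        rw [pow_zero]
        exact Submodule.algebraMap_mem t
      · exact zero_mem _
    | add f g _ _ hf hg => rw [map_add, coeff_add]; exact add_mem (hf n) (hg n)
    | mul f g _ _ hf hg =>
      rw [map_mul, coeff_mul]
      refine sum_mem fun p hp => ?_
      rw [← Finset.HasAntidiagonal.mem_antidiagonal.1 hp, pow_add]
      exact Submodule.mul_mem_mul (hf _) (hg _)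
  · intro i f
    change (δ (x i * f)).coeff 0 = 0
    rw [map_mul, hδ, mul_coeff_zero, coeff_monomial_of_ne _ (by decide), zero_mul]
  · intro n i f
    change (δ (x i * f)).coeff (n + 1) = x i * (δ f).coeff n
    rw [map_mul, hδ, coeff_monomial_mul]

/-- The right-module map whose image is the first syzygies of the generators. -/
def syzMap (a b c : K) (x : Fin 4 → A) : (Fin 3 → A) × (Fin 3 → A) →ₗ[K] Fin 4 → A where
  toFun h := ![(b + c) • (x 1 * h.1 0) + (c + a) • (x 2 * h.1 1) + (a + b) • (x 3 * h.1 2),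
    (b + c) • (x 0 * h.2 0) + c • (x 3 * h.2 1) - b • (x 2 * h.2 2) +
      (a • (x 3 * h.1 1) - a • (x 2 * h.1 2)),
    (c + a) • (x 0 * h.2 1) - c • (x 3 * h.2 0) + a • (x 1 * h.2 2) +
      (b • (x 1 * h.1 2) - b • (x 3 * h.1 0)),
    (a + b) • (x 0 * h.2 2) + b • (x 2 * h.2 0) - a • (x 1 * h.2 1) +
      (c • (x 2 * h.1 0) - c • (x 1 * h.1 1))]
  map_add' g h := by
    ext i
    fin_cases i <;> simp [mul_add] <;> module
  map_smul' t h := by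
    ext i
    fin_cases i <;> simp [smul_sub, smul_add, smul_comm t]

theorem SkRel.mul_r01 (h : SkRel a b c x) (u : A) :
    (b + c) • (x 0 * (x 1 * u)) = b • (x 2 * (x 3 * u)) - c • (x 3 * (x 2 * u)) := by
  simpa only [sub_mul, smul_mul_assoc, mul_assoc] using congrArg (· * u) h.r01

theorem SkRel.mul_r10 (h : SkRel a b c x) (u : A) :
    (b + c) • (x 1 * (x 0 * u)) = c • (x 2 * (x 3 * u)) - b • (x 3 * (x 2 * u)) := by
  simpa only [sub_mul, smul_mul_assoc, mul_assoc] using congrArg (· * u) h.r10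

theorem SkRel.mul_r02 (h : SkRel a b c x) (u : A) :
    (c + a) • (x 0 * (x 2 * u)) = c • (x 3 * (x 1 * u)) - a • (x 1 * (x 3 * u)) :=
  h.rotate.mul_r01 u

theorem SkRel.mul_r20 (h : SkRel a b c x) (u : A) :
    (c + a) • (x 2 * (x 0 * u)) = a • (x 3 * (x 1 * u)) - c • (x 1 * (x 3 * u)) :=
  h.rotate.mul_r10 u

theorem SkRel.mul_r03 (h : SkRel a b c x) (u : A) :
    (a + b) • (x 0 * (x 3 * u)) = a • (x 1 * (x 2 * u)) - b • (x 2 * (x 1 * u)) :=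
  h.rotate.rotate.mul_r01 u

theorem SkRel.mul_r30 (h : SkRel a b c x) (u : A) :
    (a + b) • (x 3 * (x 0 * u)) = b • (x 1 * (x 2 * u)) - a • (x 2 * (x 1 * u)) :=
  h.rotate.rotate.mul_r10 u

/-- The map `g ↦ ∑ xᵢ gᵢ`. -/
def genMap (K : Type u) [Field K] [Algebra K A] (x : Fin 4 → A) : (Fin 4 → A) →ₗ[K] A :=
  ∑ i, LinearMap.mulLeft K (x i) ∘ₗ LinearMap.proj i

theorem genMap_apply (x g : Fin 4 → A) : genMap K x g = ∑ i, x i * g i := by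
  simp [genMap]

theorem SkRel.range_syzMap_le (h : SkRel a b c x) :
    LinearMap.range (syzMap a b c x) ≤ LinearMap.ker (genMap K x) := by
  rintro _ ⟨g, rfl⟩
  rw [LinearMap.mem_ker, genMap_apply, Fin.sum_univ_four]
  simp only [syzMap, LinearMap.coe_mk, AddHom.coe_mk, Matrix.cons_val, mul_add, mul_sub, mul_smul_comm]
  linear_combination (norm := module) h.mul_r01 (g.1 0) + h.mul_r02 (g.1 1) + h.mul_r03 (g.1 2) +
    h.mul_r10 (g.2 0) + h.mul_r20 (g.2 1) + h.mul_r30 (g.2 2)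

/-- The first syzygies of the generators come from the defining relations. -/
theorem IsSklyanin.mem_range_syzMap (h : IsSklyanin a b c x) {g : Fin 4 → A}
    (hg : ∑ i, x i * g i = 0) : g ∈ LinearMap.range (syzMap a b c x) := by
  set N := LinearMap.range (syzMap a b c x) with hN
  let π : K × ((Fin 4 → A) ⧸ N) →ₗ[K] A :=
    (Algebra.linearMap K A).coprod (N.liftQ (genMap K x) h.range_syzMap_le)
  let ι (i : Fin 4) : A →ₗ[K] K × ((Fin 4 → A) ⧸ N) :=
    LinearMap.inr K K _ ∘ₗ N.mkQ ∘ₗ LinearMap.single K (fun _ => A) i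
  have hι : ∀ i u, ι i u = (0, N.mkQ (Pi.single i u)) := fun i u => rfl
  have hπι : ∀ i u, π (ι i u) = x i * u := by
    intro i u
    simp [π, hι, genMap_apply, Pi.single_apply]
  have key : ∀ p : (Fin 3 → A) × (Fin 3 → A), ∑ i, ι i (syzMap a b c x p i) = 0 := by
    intro p
    have : N.mkQ (syzMap a b c x p) = 0 := by
      rw [Submodule.mkQ_apply, Submodule.Quotient.mk_eq_zero]
      exact ⟨p, rfl⟩
    rw [← Finset.univ_sum_single (syzMap a b c x p), map_sum] at this
    simp only [hι]
    ext
    · simp [Prod.fst_sum]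
    · rw [Prod.snd_sum, this]; rfl
  obtain ⟨Ψ, hΨ⟩ := h.exists_lift (Module.End K (K × ((Fin 4 → A) ⧸ N))) (fun i => ι i ∘ₗ π) (by
    constructor <;> refine LinearMap.ext fun z => ?_ <;>
      simp only [LinearMap.smul_apply, LinearMap.sub_apply, Module.End.mul_apply,
        LinearMap.comp_apply, hπι]
    · have := key (![π z, 0, 0], 0)
      simp [syzMap, Fin.sum_univ_four] at this
      linear_combination (norm := module) this
    · have := key (0, ![π z, 0, 0])
      simp [syzMap, Fin.sum_univ_four] at this
      linear_combination (norm := module) this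
    · have := key (![0, π z, 0], 0)
      simp [syzMap, Fin.sum_univ_four] at this
      linear_combination (norm := module) this
    · have := key (0, ![0, π z, 0])
      simp [syzMap, Fin.sum_univ_four] at this
      linear_combination (norm := module) this
    · have := key (![0, 0, π z], 0)
      simp [syzMap, Fin.sum_univ_four] at this
      linear_combination (norm := module) this
    · have := key (0, ![0, 0, π z])
      simp [syzMap, Fin.sum_univ_four] at this
      linear_combination (norm := module) this)
  have hπΨ : ∀ f z, π (Ψ f z) = f * π z := by
    intro f
    have hf : f ∈ Algebra.adjoin K (Set.range x) := h.adjoin_eq ▸ trivial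
    induction hf using Algebra.adjoin_induction with
    | mem f hf => obtain ⟨i, rfl⟩ := hf; intro z; rw [hΨ]; exact hπι i _
    | algebraMap t => intro z; simp [Algebra.smul_def]
    | add f g _ _ hf hg => intro z; simp [hf, hg, add_mul]
    | mul f g _ _ hf hg => intro z; simp [hf, hg, mul_assoc]
  have h1 : ∀ i, Ψ (x i * g i) (1, 0) = ι i (g i) := by
    intro i
    rw [map_mul, hΨ, Module.End.mul_apply, LinearMap.comp_apply, hπΨ]
    simp [π]
  have h0 : ∑ i, ι i (g i) = 0 := by
    simp_rw [← h1, ← LinearMap.sum_apply, ← map_sum, hg, map_zero, LinearMap.zero_apply]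
  simp only [hι] at h0
  have := congrArg Prod.snd h0
  rw [Prod.snd_sum] at this
  simp only [← map_sum, Finset.univ_sum_single] at this
  rwa [Prod.snd_zero, Submodule.mkQ_apply, Submodule.Quotient.mk_eq_zero] at this

end Presentation

section Syzygies
universe u
variable {K A : Type u} [Field K] [Ring A] [Algebra K A] {a b c : K} {x : Fin 4 → A}

/-- The piece of degree `n - j`, which is zero when `n < j`. -/
def shiftPow (V : Submodule K A) (j n : ℕ) : Submodule K A := if n < j then ⊥ else V ^ (n - j)

/-- The map `g ↦ x₁ g₁ + x₂ g₂ + x₃ g₃`. -/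
def tailMap (K : Type u) [Field K] [Algebra K A] (x : Fin 4 → A) : (Fin 3 → A) →ₗ[K] A :=
  ∑ i, LinearMap.mulLeft K (x (Fin.succ i)) ∘ₗ LinearMap.proj i

theorem tailMap_apply (x : Fin 4 → A) (g : Fin 3 → A) :
    tailMap K x g = x 1 * g 0 + x 2 * g 1 + x 3 * g 2 := by
  simp [tailMap, Fin.sum_univ_three]

/-- The syzygies of `x₁, x₂, x₃`. -/
def tailSyz (a b c : K) (x : Fin 4 → A) : (Fin 3 → A) →ₗ[K] Fin 3 → A where
  toFun h := ![(b + c) • (x 0 * h 0) + c • (x 3 * h 1) - b • (x 2 * h 2),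
    (c + a) • (x 0 * h 1) - c • (x 3 * h 0) + a • (x 1 * h 2),
    (a + b) • (x 0 * h 2) + b • (x 2 * h 0) - a • (x 1 * h 1)]
  map_add' g h := by
    ext i
    fin_cases i <;> simp [mul_add] <;> module
  map_smul' t h := by
    ext i
    fin_cases i <;> simp [smul_sub, smul_add, smul_comm t]

/-- The map `f ↦ (x₁ f, x₂ f, x₃ f)`. -/
def tailDiag (K : Type u) [Field K] [Algebra K A] (x : Fin 4 → A) : A →ₗ[K] Fin 3 → A :=
  LinearMap.pi fun i => LinearMap.mulLeft K (x (Fin.succ i))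

theorem SkRel.tailSyz_tailDiag (h : SkRel a b c x) (f : A) :
    tailSyz a b c x (tailDiag K x f) = 0 := by
  ext i
  fin_cases i <;> simp [tailSyz, tailDiag]
  · linear_combination (norm := module) h.mul_r01 f
  · linear_combination (norm := module) h.mul_r02 f
  · linear_combination (norm := module) h.mul_r03 f

theorem SkRel.exists_tailSyz_eq (h : SkRel a b c x) (hadm : Admissible a b c) {f g : Fin 3 → A}
    (h₀ : (b + c) • g 0 = tailSyz a b c x f 0) (h₁ : (c + a) • g 1 = tailSyz a b c x f 1)
    (h₂ : (a + b) • g 2 = tailSyz a b c x f 2) :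
    ![a • (x 3 * g 1) - a • (x 2 * g 2), b • (x 1 * g 2) - b • (x 3 * g 0),
      c • (x 2 * g 0) - c • (x 1 * g 1)] = tailSyz a b c x
        ![(b + c)⁻¹ • (b • (x 3 * f 1) - c • (x 2 * f 2)),
          (c + a)⁻¹ • (c • (x 1 * f 2) - a • (x 3 * f 0)),
          (a + b)⁻¹ • (a • (x 2 * f 0) - b • (x 1 * f 1))] := by
  obtain ⟨hbc, hca, hab⟩ := hadm
  have solve : ∀ {s : K} {u v : A}, s ≠ 0 → s • u = v → u = s⁻¹ • v := by
    rintro s u _ hs rfl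
    rw [smul_smul, inv_mul_cancel₀ hs, one_smul]
  rw [solve hbc h₀, solve hca h₁, solve hab h₂]
  have r01 := fun u => solve hbc (h.mul_r01 u)
  have r10 := fun u => solve hbc (h.mul_r10 u)
  have r02 := fun u => solve hca (h.mul_r02 u)
  have r20 := fun u => solve hca (h.mul_r20 u)
  have r03 := fun u => solve hab (h.mul_r03 u)
  have r30 := fun u => solve hab (h.mul_r30 u)
  ext i
  fin_cases i <;>
    simp [tailSyz, mul_add, mul_sub, r01, r10, r02, r20, r03, r30] <;>
    match_scalars <;> field_simp <;> ring

theorem mul_mem_of_mem_shiftPow (i : Fin 4) {n : ℕ} {f : A}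
    (hf : f ∈ shiftPow (Submodule.span K (Set.range x)) 1 n) :
    x i * f ∈ Submodule.span K (Set.range x) ^ n := by
  cases n with
  | zero =>
    rw [shiftPow, if_pos one_pos, Submodule.mem_bot] at hf
    simp [hf]
  | succ n =>
    rw [shiftPow, if_neg (by omega), Nat.add_sub_cancel] at hf
    rw [pow_succ']
    exact Submodule.mul_mem_mul (mem_span_gens x i) hf

/-- Homogeneous first syzygies have homogeneous preimages. -/
theorem IsSklyanin.exists_homogeneous (h : IsSklyanin a b c x) {n : ℕ} {g : Fin 4 → A}
    (hgn : ∀ i, g i ∈ Submodule.span K (Set.range x) ^ n) (hg : ∑ i, x i * g i = 0) :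
    ∃ p : (Fin 3 → A) × (Fin 3 → A),
      (∀ i, p.1 i ∈ shiftPow (Submodule.span K (Set.range x)) 1 n) ∧
      (∀ i, p.2 i ∈ shiftPow (Submodule.span K (Set.range x)) 1 n) ∧ syzMap a b c x p = g := by
  obtain ⟨pr, hpr, hmem, hpr₀, hprs⟩ := h.exists_grading
  obtain ⟨p, rfl⟩ := h.mem_range_syzMap hg
  cases n with
  | zero =>
    refine ⟨0, fun i => zero_mem _, fun i => zero_mem _, ?_⟩
    rw [map_zero]
    ext i
    rw [← hpr 0 _ (hgn i)]
    fin_cases i <;> simp [syzMap, hpr₀]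
  | succ n =>
    refine ⟨(fun i => pr n (p.1 i), fun i => pr n (p.2 i)), fun i => ?_, fun i => ?_, ?_⟩
    · simpa [shiftPow] using hmem n (p.1 i)
    · simpa [shiftPow] using hmem n (p.2 i)
    · ext i
      rw [← hpr (n + 1) _ (hgn i)]
      fin_cases i <;> simp [syzMap, hprs]

theorem IsSklyanin.exists_tailSyz (h : IsSklyanin a b c x) (hadm : Admissible a b c) {n : ℕ}
    {g : Fin 3 → A} (hgn : ∀ i, g i ∈ Submodule.span K (Set.range x) ^ n)
    (hg : tailMap K x g = 0) :
    ∃ f : Fin 3 → A, (∀ i, f i ∈ shiftPow (Submodule.span K (Set.range x)) 1 n) ∧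
      tailSyz a b c x f = g := by
  set V := Submodule.span K (Set.range x) with hV
  induction n generalizing g with
  | zero =>
    obtain ⟨p, hp₁, hp₂, hp⟩ := h.exists_homogeneous (n := 0) (g := Fin.cons 0 g)
      (Fin.cases (zero_mem _) hgn) (by
        rw [tailMap_apply] at hg
        simpa [Fin.sum_univ_succ, add_assoc] using hg)
    simp only [shiftPow, if_pos one_pos, Submodule.mem_bot] at hp₁ hp₂
    have hp0 : p = 0 := Prod.ext (funext hp₁) (funext hp₂)
    rw [hp0, map_zero] at hp
    refine ⟨0, fun i => zero_mem _, ?_⟩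
    rw [map_zero]
    ext i
    simpa using congrFun hp i.succ
  | succ n ih =>
    obtain ⟨⟨r, s⟩, hr, hs, hp⟩ := h.exists_homogeneous (n := n + 1) (g := Fin.cons 0 g)
      (Fin.cases (zero_mem _) hgn) (by
        rw [tailMap_apply] at hg
        simpa [Fin.sum_univ_succ, add_assoc] using hg)
    simp only [shiftPow, if_neg (show ¬ n + 1 < 1 by omega), Nat.add_sub_cancel] at hr hs ⊢
    obtain ⟨f, hf, hfr⟩ := ih (g := ![(b + c) • r 0, (c + a) • r 1, (a + b) • r 2])
      (by
        rw [tailMap_apply]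
        simpa [syzMap] using congrFun hp 0)
      (by intro i; fin_cases i <;> exact Submodule.smul_mem _ _ (hr _))
    have e := h.exists_tailSyz_eq hadm (f := f) (g := r) (by rw [hfr]; rfl) (by rw [hfr]; rfl)
      (by rw [hfr]; rfl)
    have hxf : ∀ i j (t : K), t • (x i * f j) ∈ V ^ n := fun i j t =>
      Submodule.smul_mem _ _ (mul_mem_of_mem_shiftPow i (hf j))
    refine ⟨![(b + c)⁻¹ • (b • (x 3 * f 1) - c • (x 2 * f 2)),
      (c + a)⁻¹ • (c • (x 1 * f 2) - a • (x 3 * f 0)),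
      (a + b)⁻¹ • (a • (x 2 * f 0) - b • (x 1 * f 1))] + s, fun i => add_mem ?_ (hs i), ?_⟩
    · fin_cases i <;> exact Submodule.smul_mem _ _ (sub_mem (hxf _ _ _) (hxf _ _ _))
    · rw [map_add, ← e]
      ext i
      have := congrFun hp i.succ
      rw [Fin.cons_succ] at this
      rw [← this]
      fin_cases i <;> simp [syzMap, tailSyz] <;> abel

/-- Triples with entries in a given subspace. -/
def triples (S : Submodule K A) : Submodule K (Fin 3 → A) :=
  LinearMap.range (S.subtype.compLeft (Fin 3))

theorem mem_triples {S : Submodule K A} {g : Fin 3 → A} : g ∈ triples S ↔ ∀ i, g i ∈ S := by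
  simp [triples, LinearMap.range_compLeft, Submodule.mem_pi]

instance (S : Submodule K A) [FiniteDimensional K S] : FiniteDimensional K (triples S) :=
  inferInstanceAs (FiniteDimensional K (LinearMap.range (S.subtype.compLeft (Fin 3))))

theorem finrank_triples (S : Submodule K A) [FiniteDimensional K S] :
    Module.finrank K (triples S) = 3 * Module.finrank K S := by
  rw [triples, LinearMap.finrank_range_of_inj, Module.finrank_pi_fintype]
  · simp
  · intro g h e
    ext i
    exact congrFun e i

theorem finrank_map_add_finrank_inf_ker {M N : Type*} [AddCommGroup M] [Module K M]
    [AddCommGroup N] [Module K N] (f : M →ₗ[K] N) (E : Submodule K M) [FiniteDimensional K E] :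
    Module.finrank K (E.map f) + Module.finrank K ↥(E ⊓ LinearMap.ker f) = Module.finrank K E := by
  rw [← (f.domRestrict E).finrank_range_add_finrank_ker, LinearMap.range_domRestrict,
    LinearMap.ker_domRestrict]
  congr 1
  rw [← Submodule.finrank_map_subtype_eq, Submodule.map_comap_subtype]

instance (x : Fin 4 → A) (n : ℕ) : FiniteDimensional K ↥(Submodule.span K (Set.range x) ^ n) :=
  Module.Finite.iff_fg.2 (Submodule.FG.pow (Submodule.fg_span (Set.finite_range x)) n)

instance (x : Fin 4 → A) (j n : ℕ) :
    FiniteDimensional K ↥(shiftPow (Submodule.span K (Set.range x)) j n) := by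
  by_cases h : n < j
  · rw [shiftPow, if_pos h]
    infer_instance
  · rw [shiftPow, if_neg h]
    infer_instance

theorem finrank_shiftPow {V : Submodule K A} {j n : ℕ}
    (hV : ∀ m ≤ n, Module.finrank K ↥(V ^ m) = (m + 3).choose 3) :
    Module.finrank K (shiftPow V j n) = (n + 3 - j).choose 3 := by
  by_cases h : n < j
  · rw [shiftPow, if_pos h, finrank_bot, Nat.choose_eq_zero_of_lt (by omega)]
  · rw [shiftPow, if_neg h, hV _ (Nat.sub_le n j)]
    congr 1
    omega

/-- A first flag element is left regular in the degrees where the Hilbert series is known. -/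
theorem FlagBound.eq_zero_of_mul_eq_zero {P : A} (hP : FlagBound (K := K) x P) {n : ℕ}
    (h₀ : Module.finrank K ↥(Submodule.span K (Set.range x) ^ n) = (n + 3).choose 3)
    (h₁ : Module.finrank K ↥(Submodule.span K (Set.range x) ^ (n + 1)) = (n + 4).choose 3)
    {f : A} (hf : f ∈ Submodule.span K (Set.range x) ^ n) (hPf : P * f = 0) : f = 0 := by
  unfold FlagBound at hP
  set V := Submodule.span K (Set.range x) with hV
  obtain ⟨s, hs, hle⟩ := (hP (n + 1)).1
  have hspan : Submodule.span K {P} * V ^ n = (V ^ n).map (LinearMap.mulLeft K P) :=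
    Submodule.ext fun _ => Submodule.mem_span_singleton_mul
  rw [rightIdealPart, hspan] at hle
  have h₂ := finrank_map_add_finrank_inf_ker (LinearMap.mulLeft K P) (V ^ n)
  have h₃ := (Submodule.finrank_mono hle).trans (Submodule.finrank_add_le_finrank_add_finrank _ _)
  have h₄ : Module.finrank K (Submodule.span K (s : Set A)) ≤ s.card :=
    finrank_span_finset_le_card s
  have h₅ : (n + 4).choose 3 = (n + 3).choose 2 + (n + 3).choose 3 :=
    Nat.choose_succ_succ' (n + 3) 2
  rw [show n + 1 + 2 = n + 3 from rfl] at hs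
  have h₆ : Module.finrank K ↥(V ^ n ⊓ LinearMap.ker (LinearMap.mulLeft K P)) = 0 := by omega
  have : f ∈ V ^ n ⊓ LinearMap.ker (LinearMap.mulLeft K P) := ⟨hf, hPf⟩
  rwa [Submodule.finrank_eq_zero.1 h₆, Submodule.mem_bot] at this

theorem IsSklyanin.pow_notMem (h : IsSklyanin a b c x) (n : ℕ) (g : Fin 3 → A) :
    tailMap K x g ≠ x 0 ^ n := by
  intro e
  obtain ⟨χ, hχ⟩ := h.exists_lift (Polynomial K) ![Polynomial.X, 0, 0, 0]
    (by constructor <;> simp)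
  have := congrArg χ e
  rw [tailMap_apply] at this
  simp only [map_add, map_mul, map_pow, hχ, Matrix.cons_val, zero_mul, add_zero] at this
  exact pow_ne_zero n Polynomial.X_ne_zero this.symm

/-- Exactness of the truncated Koszul-type complex bounds the next Hilbert series coefficient. -/
theorem IsSklyanin.choose_le_finrank (h : IsSklyanin a b c x) (hadm : Admissible a b c) {P : A}
    (hP : FlagBound (K := K) x P) (hPs : P ∈ Submodule.span K {x 1, x 2, x 3}) {n : ℕ}
    (hn : ∀ m ≤ n,
      Module.finrank K ↥(Submodule.span K (Set.range x) ^ m) = (m + 3).choose 3) :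
    (n + 4).choose 3 ≤ Module.finrank K ↥(Submodule.span K (Set.range x) ^ (n + 1)) := by
  set V := Submodule.span K (Set.range x) with hV
  have d₁ := finrank_map_add_finrank_inf_ker (tailMap K x) (triples (V ^ n))
  have d₂ := finrank_map_add_finrank_inf_ker (tailSyz a b c x) (triples (shiftPow V 1 n))
  have d₃ := finrank_map_add_finrank_inf_ker (tailDiag K x) (shiftPow V 2 n)
  rw [finrank_triples, hn n le_rfl] at d₁
  rw [finrank_triples, finrank_shiftPow hn] at d₂
  rw [finrank_shiftPow hn] at d₃
  have l₁ : triples (V ^ n) ⊓ LinearMap.ker (tailMap K x) ≤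
      (triples (shiftPow V 1 n)).map (tailSyz a b c x) := by
    rintro g ⟨hg, hg'⟩
    obtain ⟨f, hf, rfl⟩ := h.exists_tailSyz hadm (mem_triples.1 hg) hg'
    exact ⟨f, mem_triples.2 hf, rfl⟩
  have l₂ : (shiftPow V 2 n).map (tailDiag K x) ≤
      triples (shiftPow V 1 n) ⊓ LinearMap.ker (tailSyz a b c x) := by
    rintro _ ⟨f, hf, rfl⟩
    refine ⟨mem_triples.2 fun i => ?_, h.tailSyz_tailDiag f⟩
    have : ∀ m, n = m + 1 → x i.succ * f ∈ V ^ m := by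
      rintro m rfl
      refine mul_mem_of_mem_shiftPow _ ?_
      rw [← hV, shiftPow]
      simpa [shiftPow, show m + 1 < 2 ↔ m < 1 by omega, show m + 1 - 2 = m - 1 by omega] using hf
    cases n with
    | zero =>
      rw [SetLike.mem_coe, shiftPow, if_pos (by omega), Submodule.mem_bot] at hf
      rw [hf, map_zero]
      exact zero_mem _
    | succ m =>
      rw [shiftPow, if_neg (by omega)]
      exact this m rfl
  have l₃ : shiftPow V 2 n ⊓ LinearMap.ker (tailDiag K x) = ⊥ := by
    refine (Submodule.eq_bot_iff _).2 ?_
    rintro f ⟨hf, hf'⟩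
    have hPf : P * f = 0 := by
      have hle : Submodule.span K {x 1, x 2, x 3} ≤ LinearMap.ker (LinearMap.mulRight K f) := by
        rw [Submodule.span_le]
        rintro _ (rfl | rfl | rfl)
        exacts [congrFun hf' 0, congrFun hf' 1, congrFun hf' 2]
      exact hle hPs
    by_cases hlt : n < 2
    · rwa [SetLike.mem_coe, shiftPow, if_pos hlt] at hf
    · obtain ⟨m, rfl⟩ : ∃ m, n = m + 2 := ⟨n - 2, by omega⟩
      rw [SetLike.mem_coe, shiftPow, if_neg hlt, Nat.add_sub_cancel] at hf
      exact hP.eq_zero_of_mul_eq_zero (hn m (by omega)) (hn (m + 1) (by omega)) hf hPf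
  have l₄ : (triples (V ^ n)).map (tailMap K x) < V ^ (n + 1) := by
    refine lt_of_le_of_ne ?_ fun e => ?_
    · rintro _ ⟨g, hg, rfl⟩
      rw [tailMap_apply, pow_succ']
      have hg := mem_triples.1 hg
      exact add_mem (add_mem (Submodule.mul_mem_mul (mem_span_gens x _) (hg _))
        (Submodule.mul_mem_mul (mem_span_gens x _) (hg _)))
        (Submodule.mul_mem_mul (mem_span_gens x _) (hg _))
    · have := Submodule.pow_mem_pow V (mem_span_gens x 0) (n + 1)
      rw [← e] at this
      obtain ⟨g, -, hg⟩ := this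
      exact h.pow_notMem _ g hg
  have m₁ := Submodule.finrank_mono l₁
  have m₂ := Submodule.finrank_mono l₂
  have m₄ := Submodule.finrank_lt_finrank_of_lt l₄
  rw [l₃, finrank_bot] at d₃
  have c₁ := Nat.choose_succ_succ' (n + 1) 2
  have c₂ := Nat.choose_succ_succ' (n + 2) 2
  have c₃ := Nat.choose_succ_succ' (n + 3) 2
  have c₄ := Nat.choose_succ_succ' (n + 1) 1
  have c₅ := Nat.choose_succ_succ' (n + 2) 1
  simp only [Nat.choose_one_right, Nat.add_assoc, Nat.reduceAdd, Nat.reduceSubDiff] at *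
  omega

theorem IsSklyanin.finrank_pow [IsAlgClosed K] (h : IsSklyanin a b c x) (hadm : Admissible a b c)
    (h2 : (2 : K) ≠ 0) (n : ℕ) :
    Module.finrank K ↥(Submodule.span K (Set.range x) ^ n) = (n + 3).choose 3 := by
  obtain ⟨P, hPs, hP⟩ := h.toSkRel.exists_flagBound hadm h2
  induction n using Nat.strong_induction_on with
  | _ n ih =>
    refine le_antisymm (hP n).2.finrank_le ?_
    cases n with
    | zero =>
      have : (1 : A) ≠ 0 := fun e => h.pow_notMem 0 0 (by rw [map_zero, pow_zero, e])
      rw [pow_zero, Submodule.one_eq_span, finrank_span_singleton this]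
      rfl
    | succ n => exact h.choose_le_finrank hadm hP hPs fun m hm => ih m (by omega)

end Syzygies

section Parameters
variable {K : Type*} [Field K] {α β γ : K}

/-- Symmetric parameters for the relations of `A(α,β,γ)`. -/
def IsSymmParam (α β γ a b c : K) : Prop :=
  Admissible a b c ∧ (b + c) * α = b - c ∧ (c + a) * β = c - a ∧ (a + b) * γ = a - b

theorem IsSymmParam.rotate {a b c : K} (h : IsSymmParam α β γ a b c) : IsSymmParam β γ α b c a :=
  ⟨⟨h.1.hca, h.1.hab, h.1.hbc⟩, h.2.2.1, h.2.2.2, h.2.1⟩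

theorem exists_isSymmParam_of_eq_one (h2 : (2 : K) ≠ 0) (hS : α + β + γ + α * β * γ = 0)
    (hα : α = 1) (hγ : γ ≠ -1) (hβγ : ¬(β = -1 ∧ γ = 1)) : ∃ a b c, IsSymmParam α β γ a b c := by
  subst hα
  have hβ : β = -1 := by
    have : (β + 1) * (γ + 1) = 0 := by linear_combination hS
    rcases mul_eq_zero.1 this with h | h
    · exact eq_neg_of_add_eq_zero_left h
    · exact absurd (eq_neg_of_add_eq_zero_left h) hγ
  have hγ₁ : γ ≠ 1 := fun h => hβγ ⟨hβ, h⟩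
  refine ⟨1 + γ, 1 - γ, 0, ⟨?_, ?_, ?_⟩, by ring, by rw [hβ]; ring, by ring⟩
  · rw [add_zero]
    exact sub_ne_zero.2 hγ₁.symm
  · rw [zero_add, add_comm]
    exact fun h => hγ (eq_neg_of_add_eq_zero_left h)
  · intro h
    exact h2 (by linear_combination h)

theorem exists_isSymmParam_of_eq_neg_one (h2 : (2 : K) ≠ 0) (hS : α + β + γ + α * β * γ = 0)
    (hα : α = -1) (hβ : β ≠ 1) (hβγ : ¬(β = -1 ∧ γ = 1)) : ∃ a b c, IsSymmParam α β γ a b c := by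
  have hγ : γ = 1 := by
    have : (β - 1) * (γ - 1) = 0 := by
      subst hα
      linear_combination -hS
    rcases mul_eq_zero.1 this with h | h
    · exact absurd (sub_eq_zero.1 h) hβ
    · exact sub_eq_zero.1 h
  obtain ⟨a, b, c, h⟩ := exists_isSymmParam_of_eq_one (α := γ) (β := α) (γ := β) h2
    (by linear_combination hS) hγ (fun h => hβγ ⟨h, hγ⟩) (fun h => hβ h.2)
  exact ⟨_, _, _, h.rotate⟩

theorem exists_isSymmParam_of_sq_eq_one (h2 : (2 : K) ≠ 0) (hS : α + β + γ + α * β * γ = 0)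
    (hα : α = 1 ∨ α = -1) (h₁ : ¬(α = -1 ∧ β = 1)) (h₂ : ¬(β = -1 ∧ γ = 1))
    (h₃ : ¬(α = 1 ∧ γ = -1)) : ∃ a b c, IsSymmParam α β γ a b c := by
  rcases hα with h | h
  · exact exists_isSymmParam_of_eq_one h2 hS h (fun h' => h₃ ⟨h, h'⟩) h₂
  · exact exists_isSymmParam_of_eq_neg_one h2 hS h (fun h' => h₁ ⟨h, h'⟩) h₂

theorem exists_isSymmParam (h2 : (2 : K) ≠ 0) (hS : α + β + γ + α * β * γ = 0)
    (h₁ : ¬(α = -1 ∧ β = 1)) (h₂ : ¬(β = -1 ∧ γ = 1)) (h₃ : ¬(α = 1 ∧ γ = -1)) :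
    ∃ a b c, IsSymmParam α β γ a b c := by
  by_cases hα : α = 1 ∨ α = -1
  · exact exists_isSymmParam_of_sq_eq_one h2 hS hα h₁ h₂ h₃
  by_cases hβ : β = 1 ∨ β = -1
  · obtain ⟨b, c, a, h⟩ := exists_isSymmParam_of_sq_eq_one (α := β) (β := γ) (γ := α) h2
      (by linear_combination hS) hβ h₂ (fun h => h₃ h.symm) (fun h => h₁ h.symm)
    exact ⟨_, _, _, h.rotate.rotate⟩
  push Not at hα hβ
  have hβ' : 1 + β ≠ 0 := fun h => hβ.2 (by linear_combination h)
  have hα' : 1 - α ≠ 0 := sub_ne_zero.2 hα.1.symm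
  have hγ : (1 + α * β) * (1 + γ) = (1 - α) * (1 - β) := by linear_combination hS
  have hαβ : 1 + α * β ≠ 0 := by
    intro h
    rw [h, zero_mul, eq_comm] at hγ
    exact mul_ne_zero hα' (sub_ne_zero.2 hβ.1.symm) hγ
  refine ⟨(1 - α) * (1 - β), (1 + α) * (1 + β), (1 - α) * (1 + β), ⟨?_, ?_, ?_⟩, by ring, by ring,
    by linear_combination 2 * hS⟩
  · rw [show (1 + α) * (1 + β) + (1 - α) * (1 + β) = 2 * (1 + β) by ring]
    exact mul_ne_zero h2 hβ'
  · rw [show (1 - α) * (1 + β) + (1 - α) * (1 - β) = 2 * (1 - α) by ring]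
    exact mul_ne_zero h2 hα'
  · rw [show (1 - α) * (1 - β) + (1 + α) * (1 + β) = 2 * (1 + α * β) by ring]
    exact mul_ne_zero h2 hαβ

end Parameters

section Identification
variable {K A : Type*} [Field K] [Ring A] [Algebra K A] {a b c α : K}

/-- The two relations between `x₀, x₁` and `x₂, x₃` in the two parametrisations. -/
theorem comm_anticomm_iff (h2 : (2 : K) ≠ 0) (hbc : b + c ≠ 0) (hα : (b + c) * α = b - c)
    {p q r s : A} :
    (p - q - algebraMap K A α * (r + s) = 0 ∧ p + q - (r - s) = 0) ↔
      (b + c) • p = b • r - c • s ∧ (b + c) • q = c • r - b • s := by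
  have hα' : α = (b - c) / (b + c) := by
    rw [eq_div_iff hbc]
    linear_combination hα
  rw [← Algebra.smul_def, hα']
  constructor
  · rintro ⟨hc, ha⟩
    have hp : p = (2 : K)⁻¹ • (((b - c) / (b + c)) • (r + s) + (r - s)) := by
      linear_combination (norm := (match_scalars <;> field_simp <;> ring))
        (2 : K)⁻¹ • hc + (2 : K)⁻¹ • ha
    have hq : q = (2 : K)⁻¹ • ((r - s) - ((b - c) / (b + c)) • (r + s)) := by
      linear_combination (norm := (match_scalars <;> field_simp <;> ring))
        (2 : K)⁻¹ • ha - (2 : K)⁻¹ • hc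
    rw [hp, hq]
    constructor <;> match_scalars <;> field_simp <;> ring
  · rintro ⟨hp, hq⟩
    have hp : p = (b + c)⁻¹ • (b • r - c • s) := by rw [← hp, inv_smul_smul₀ hbc]
    have hq : q = (b + c)⁻¹ • (c • r - b • s) := by rw [← hq, inv_smul_smul₀ hbc]
    rw [hp, hq]
    constructor <;> match_scalars <;> field_simp <;> ring

end Identification

section Presentation4
variable {k} {α β γ a b c : k}

theorem agen_skRel (h2 : (2 : k) ≠ 0) (h : IsSymmParam α β γ a b c) :
    SkRel a b c (agen k α β γ) := by
  obtain ⟨⟨hbc, hca, hab⟩, hα, hβ, hγ⟩ := h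
  have rel : ∀ {p}, fourRel k α β γ p 0 → RingQuot.mkAlgHom k (fourRel k α β γ) p = 0 :=
    fun hp => (RingQuot.mkAlgHom_rel k hp).trans (map_zero _)
  have e₁ := (comm_anticomm_iff h2 hbc hα).1
    ⟨by simpa using rel ⟨rfl, .inl rfl⟩, by simpa using rel ⟨rfl, .inr (.inl rfl)⟩⟩
  have e₂ := (comm_anticomm_iff h2 hca hβ).1
    ⟨by simpa using rel ⟨rfl, .inr (.inr (.inl rfl))⟩,
      by simpa using rel ⟨rfl, .inr (.inr (.inr (.inl rfl)))⟩⟩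
  have e₃ := (comm_anticomm_iff h2 hab hγ).1
    ⟨by simpa using rel ⟨rfl, .inr (.inr (.inr (.inr (.inl rfl))))⟩,
      by simpa using rel ⟨rfl, .inr (.inr (.inr (.inr (.inr rfl))))⟩⟩
  exact ⟨e₁.1, e₁.2, e₂.1, e₂.2, e₃.1, e₃.2⟩

theorem agen_isSklyanin (h2 : (2 : k) ≠ 0) (h : IsSymmParam α β γ a b c) :
    IsSklyanin a b c (agen k α β γ) where
  toSkRel := agen_skRel h2 h
  adjoin_eq := by
    have : Set.range (agen k α β γ) =
        RingQuot.mkAlgHom k (fourRel k α β γ) '' Set.range (FreeAlgebra.ι k) := by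
      rw [← Set.range_comp]
      rfl
    rw [this, ← AlgHom.map_adjoin, FreeAlgebra.adjoin_range_ι, Algebra.map_top,
      AlgHom.range_eq_top]
    exact RingQuot.mkAlgHom_surjective k _
  exists_lift B _ _ y hy := by
    obtain ⟨⟨hbc, hca, hab⟩, hα, hβ, hγ⟩ := h
    have e₁ := (comm_anticomm_iff h2 hbc hα).2 ⟨hy.r01, hy.r10⟩
    have e₂ := (comm_anticomm_iff h2 hca hβ).2 ⟨hy.r02, hy.r20⟩
    have e₃ := (comm_anticomm_iff h2 hab hγ).2 ⟨hy.r03, hy.r30⟩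
    refine ⟨RingQuot.liftAlgHom k ⟨FreeAlgebra.lift k y, ?_⟩, fun i => ?_⟩
    · rintro p _ ⟨rfl, rfl | rfl | rfl | rfl | rfl | rfl⟩
      · simpa [g4] using e₁.1
      · simpa [g4] using e₁.2
      · simpa [g4] using e₂.1
      · simpa [g4] using e₂.2
      · simpa [g4] using e₃.1
      · simpa [g4] using e₃.2
    · rw [agen, RingQuot.liftAlgHom_mkAlgHom_apply, g4, FreeAlgebra.lift_ι_apply]

open Pointwise in
theorem gradedPiece4_eq_pow (α β γ : k) (n : ℕ) :
    gradedPiece4 k α β γ n = Submodule.span k (Set.range (agen k α β γ)) ^ n := by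
  rw [gradedPiece4, Submodule.span_pow]
  congr 1
  induction n with
  | zero =>
    ext s
    simp [List.length_eq_zero_iff, pow_zero]
  | succ n ih =>
    rw [pow_succ', ← ih]
    ext s
    simp only [Set.mem_mul, Set.mem_range, Set.mem_ofPred_eq]
    constructor
    · rintro ⟨_ | ⟨i, w⟩, hw, rfl⟩
      · simp at hw
      · exact ⟨_, ⟨i, rfl⟩, _, ⟨w, by simpa using hw, rfl⟩, by simp⟩
    · rintro ⟨_, ⟨i, rfl⟩, _, ⟨w, rfl, rfl⟩, rfl⟩
      exact ⟨i :: w, by simp, by simp⟩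

end Presentation4

/-- Under the stated non-degeneracy conditions, the `n`-th graded component of the
four-dimensional Sklyanin algebra `S(α,β,γ)` has dimension `C(n+3,3)`; that is, `S(α,β,γ)`
has the Hilbert series `1/(1−t)⁴` of a polynomial ring in four variables. -/
theorem sklyanin4_hilbert_series [IsAlgClosed k] (hchar : ringChar k ≠ 2) (α β γ : k)
    (hS : α + β + γ + α * β * γ = 0)
    (h1 : ¬(α = -1 ∧ β = 1)) (h2 : ¬(β = -1 ∧ γ = 1)) (h3 : ¬(α = 1 ∧ γ = -1)) (n : ℕ) :
    Module.finrank k ↥(gradedPiece4 k α β γ n) = Nat.choose (n + 3) 3 := by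
  have two_ne : (2 : k) ≠ 0 := Ring.two_ne_zero hchar
  obtain ⟨a, b, c, h⟩ := exists_isSymmParam two_ne hS h1 h2 h3
  rw [gradedPiece4_eq_pow]
  exact (agen_isSklyanin two_ne h).finrank_pow h.1 two_ne n
end
end

section
/- Let k be an algebraically closed field of characteristic different from 2 and let (α,β,γ) ∈ k³ satisfy α+β+γ+αβγ = 0. If (α = −1 and β = 1), or (β = −1 and γ = 1), or (α = 1 and γ = −1), then the four-dimensional Sklyanin algebra S(α,β,γ) has zero divisors, i.e. it is not a domain. -/
noncomputable section

variable (k : Type*) [Field k]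

/-- A relation of `A(α,β,γ)` holds for the images of the generators. -/
theorem SklyA.mk_eq_zero {α β γ : k} {a : FreeAlgebra k (Fin 4)} (h : fourRel k α β γ a 0) :
    RingQuot.mkAlgHom k (fourRel k α β γ) a = 0 := by
  rw [RingQuot.mkAlgHom_rel k h, map_zero]

/-- The algebra map from `A(α,β,γ)` to the dual numbers with `xⱼ ↦ cⱼ ε`. -/
def SklyA.toDualNumber (α β γ : k) (c : Fin 4 → k) : SklyA k α β γ →ₐ[k] DualNumber k :=
  RingQuot.liftAlgHom k ⟨FreeAlgebra.lift k fun j => TrivSqZeroExt.inr (c j), by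
    rintro a b ⟨rfl, rfl | rfl | rfl | rfl | rfl | rfl⟩ <;> simp [g4]⟩

theorem SklyA.toDualNumber_agen (α β γ : k) (c : Fin 4 → k) (j : Fin 4) :
    SklyA.toDualNumber k α β γ c (agen k α β γ j) = TrivSqZeroExt.inr (c j) := by
  simp [SklyA.toDualNumber, agen, g4]

/-- A linear form `xₚ + t x_q` with `p ≠ q` is nonzero in `A(α,β,γ)`. -/
theorem SklyA.agen_add_smul_ne_zero (α β γ t : k) {p q : Fin 4} (hpq : p ≠ q) :
    agen k α β γ p + t • agen k α β γ q ≠ 0 := by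
  intro h
  have hsnd := congrArg (fun x => (SklyA.toDualNumber k α β γ (Pi.single p 1) x).snd) h
  simp [SklyA.toDualNumber_agen, hpq.symm] at hsnd

/-- If `w x + z y = 0`, `w y = z x` and `i² = -1`, then `(w - i z) (x + i y) = 0`. -/
theorem add_smul_mul_add_smul_eq_zero {R : Type*} [Ring R] [Algebra k R] {i : k}
    (hi : i * i = -1) {w x y z : R} (h₁ : w * x + z * y = 0) (h₂ : w * y = z * x) :
    (w + (-i) • z) * (x + i • y) = 0 := by
  have h : (w + (-i) • z) * (x + i • y)
      = w * x + i • (w * y) - i • (z * x) - (i * i) • (z * y) := by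
    simp only [add_mul, mul_add, smul_mul_assoc, mul_smul_comm, neg_smul, mul_smul, neg_mul,
      smul_add, smul_neg]
    abel
  rw [h, hi, h₂, neg_one_smul, add_sub_cancel_right, sub_neg_eq_add, h₁]

/-- In a ring without additive 2-torsion, the relations `[w, x] = -{y, z}` and
`{w, x} = [y, z]` give `w x = -z y`. -/
theorem mul_add_mul_eq_zero_of_relations {R : Type*} [Ring R] (hR : ∀ u : R, u + u = 0 → u = 0)
    {w x y z : R} (h₁ : w * x - x * w - -1 * (y * z + z * y) = 0)
    (h₂ : w * x + x * w - (y * z - z * y) = 0) : w * x + z * y = 0 := by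
  refine hR _ ?_
  rw [neg_one_mul] at h₁
  have h := congrArg₂ (· + ·) h₁ h₂
  rw [← add_zero (0 : R), ← h]
  abel

/-- In a ring without additive 2-torsion, the relations `[w, x] = {y, z}` and
`{w, x} = [y, z]` give `w x = y z`. -/
theorem mul_eq_mul_of_relations {R : Type*} [Ring R] (hR : ∀ u : R, u + u = 0 → u = 0)
    {w x y z : R} (h₁ : w * x - x * w - 1 * (y * z + z * y) = 0)
    (h₂ : w * x + x * w - (y * z - z * y) = 0) : w * x = y * z := by
  refine sub_eq_zero.1 (hR _ ?_)
  rw [one_mul] at h₁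
  have h := congrArg₂ (· + ·) h₁ h₂
  rw [← add_zero (0 : R), ← h]
  abel

/-- If `(α = -1 ∧ β = 1)`, `(β = -1 ∧ γ = 1)` or `(α = 1 ∧ γ = -1)`, then the
four-dimensional Sklyanin algebra `S(α,β,γ)` has zero divisors. -/
theorem sklyanin4_zero_divisors [IsAlgClosed k] (hchar : ringChar k ≠ 2) (α β γ : k)
    (hS : α + β + γ + α * β * γ = 0)
    (h : (α = -1 ∧ β = 1) ∨ (β = -1 ∧ γ = 1) ∨ (α = 1 ∧ γ = -1)) :
    ∃ a b : SklyA k α β γ, a ≠ 0 ∧ b ≠ 0 ∧ a * b = 0 := by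
  have h2 : (2 : k) ≠ 0 := Ring.two_ne_zero hchar
  obtain ⟨i, hi⟩ := IsAlgClosed.exists_eq_mul_self (-1 : k)
  have cancel_two : ∀ u : SklyA k α β γ, u + u = 0 → u = 0 := fun u hu => by
    rw [← two_smul k] at hu
    exact (smul_eq_zero_iff_right h2).1 hu
  have key : ∀ p q r : Fin 4, 0 ≠ r → p ≠ q →
      agen k α β γ 0 * agen k α β γ p + agen k α β γ r * agen k α β γ q = 0 →
      agen k α β γ 0 * agen k α β γ q = agen k α β γ r * agen k α β γ p →
      ∃ a b : SklyA k α β γ, a ≠ 0 ∧ b ≠ 0 ∧ a * b = 0 := fun p q r hr hpq h₁ h₂ =>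
    ⟨_, _, SklyA.agen_add_smul_ne_zero k α β γ (-i) hr, SklyA.agen_add_smul_ne_zero k α β γ i hpq,
      add_smul_mul_add_smul_eq_zero k hi.symm h₁ h₂⟩
  have r₁ := SklyA.mk_eq_zero k (α := α) (β := β) (γ := γ) ⟨rfl, .inl rfl⟩
  have r₂ := SklyA.mk_eq_zero k (α := α) (β := β) (γ := γ) ⟨rfl, .inr (.inl rfl)⟩
  have r₃ := SklyA.mk_eq_zero k (α := α) (β := β) (γ := γ) ⟨rfl, .inr (.inr (.inl rfl))⟩
  have r₄ := SklyA.mk_eq_zero k (α := α) (β := β) (γ := γ) ⟨rfl, .inr (.inr (.inr (.inl rfl)))⟩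
  have r₅ := SklyA.mk_eq_zero k (α := α) (β := β) (γ := γ)
    ⟨rfl, .inr (.inr (.inr (.inr (.inl rfl))))⟩
  have r₆ := SklyA.mk_eq_zero k (α := α) (β := β) (γ := γ)
    ⟨rfl, .inr (.inr (.inr (.inr (.inr rfl))))⟩
  simp only [map_add, map_sub, map_mul, AlgHom.commutes, ← agen.eq_def] at r₁ r₂ r₃ r₄ r₅ r₆
  rcases h with ⟨rfl, rfl⟩ | ⟨rfl, rfl⟩ | ⟨rfl, rfl⟩ <;>
    simp only [map_neg, map_one] at r₁ r₂ r₃ r₄ r₅ r₆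
  · exact key 1 2 3 (by decide) (by decide) (mul_add_mul_eq_zero_of_relations cancel_two r₁ r₂)
      (mul_eq_mul_of_relations cancel_two r₃ r₄)
  · exact key 2 3 1 (by decide) (by decide) (mul_add_mul_eq_zero_of_relations cancel_two r₃ r₄)
      (mul_eq_mul_of_relations cancel_two r₅ r₆)
  · exact key 3 1 2 (by decide) (by decide) (mul_add_mul_eq_zero_of_relations cancel_two r₅ r₆)
      (mul_eq_mul_of_relations cancel_two r₁ r₂)
end
end

section
/- Let k be a field and (α,β,γ) ∈ k³. Then there are k-algebra isomorphisms A(α,β,γ) ≅ A(β,γ,α) and A(α,β,γ) ≅ A(−α,−γ,−β), each mapping the k-linear span of {x₀,x₁,x₂,x₃} onto the k-linear span of {x₀,x₁,x₂,x₃}. Consequently A(α,β,γ) ≅ A(β,γ,α) ≅ A(γ,α,β) ≅ A(−α,−γ,−β) ≅ A(−β,−α,−γ) ≅ A(−γ,−β,−α). -/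
noncomputable section

variable (k : Type*) [Field k]

section

variable {k} {B : Type*} [Ring B] [Algebra k B]

/-- The family `y` satisfies the defining relations of `A(α,β,γ)`. -/
structure SatisfiesFourRel (α β γ : k) (y : Fin 4 → B) : Prop where
  comm₁ : y 0 * y 1 - y 1 * y 0 = α • (y 2 * y 3 + y 3 * y 2)
  anti₁ : y 0 * y 1 + y 1 * y 0 = y 2 * y 3 - y 3 * y 2
  comm₂ : y 0 * y 2 - y 2 * y 0 = β • (y 3 * y 1 + y 1 * y 3)
  anti₂ : y 0 * y 2 + y 2 * y 0 = y 3 * y 1 - y 1 * y 3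
  comm₃ : y 0 * y 3 - y 3 * y 0 = γ • (y 1 * y 2 + y 2 * y 1)
  anti₃ : y 0 * y 3 + y 3 * y 0 = y 1 * y 2 - y 2 * y 1

theorem satisfiesFourRel_agen (α β γ : k) : SatisfiesFourRel α β γ (agen k α β γ) := by
  have rel {a : FreeAlgebra k (Fin 4)} (h : fourRel k α β γ a 0) :
      RingQuot.mkAlgHom k (fourRel k α β γ) a = 0 := by
    simpa using RingQuot.mkAlgHom_rel k h
  constructor <;> rw [← sub_eq_zero]
  · simpa [agen, Algebra.smul_def] using rel ⟨rfl, .inl rfl⟩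
  · simpa [agen, Algebra.smul_def] using rel ⟨rfl, .inr (.inl rfl)⟩
  · simpa [agen, Algebra.smul_def] using rel ⟨rfl, .inr (.inr (.inl rfl))⟩
  · simpa [agen, Algebra.smul_def] using rel ⟨rfl, .inr (.inr (.inr (.inl rfl)))⟩
  · simpa [agen, Algebra.smul_def] using rel ⟨rfl, .inr (.inr (.inr (.inr (.inl rfl))))⟩
  · simpa [agen, Algebra.smul_def] using rel ⟨rfl, .inr (.inr (.inr (.inr (.inr rfl))))⟩

/-- The universal property of `A(α,β,γ)`. -/
theorem SatisfiesFourRel.exists_algHom {α β γ : k} {y : Fin 4 → B}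
    (h : SatisfiesFourRel α β γ y) :
    ∃ f : SklyA k α β γ →ₐ[k] B, ∀ i, f (agen k α β γ i) = y i := by
  have hlift : ∀ ⦃a b⦄, fourRel k α β γ a b → FreeAlgebra.lift k y a = FreeAlgebra.lift k y b := by
    rintro a b ⟨rfl, rfl | rfl | rfl | rfl | rfl | rfl⟩ <;>
      simp [g4, ← Algebra.smul_def, h.comm₁, h.anti₁, h.comm₂, h.anti₂, h.comm₃, h.anti₃]
  exact ⟨RingQuot.liftAlgHom k ⟨FreeAlgebra.lift k y, hlift⟩, fun i => by simp [agen, g4]⟩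

theorem SklyA.algHom_ext {α β γ : k} {f g : SklyA k α β γ →ₐ[k] B}
    (h : ∀ i, f (agen k α β γ i) = g (agen k α β γ i)) : f = g :=
  RingQuot.ringQuot_ext' k f g (FreeAlgebra.hom_ext (funext h))

/-- Mutually inverse algebra homomorphisms that send generators to linear combinations of
generators give an isomorphism that identifies the spans of the generators. -/
theorem SklyA.exists_algEquiv {α β γ α' β' γ' : k}
    (f : SklyA k α β γ →ₐ[k] SklyA k α' β' γ') (g : SklyA k α' β' γ' →ₐ[k] SklyA k α β γ)
    (hgf : ∀ i, g (f (agen k α β γ i)) = agen k α β γ i)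
    (hfg : ∀ i, f (g (agen k α' β' γ' i)) = agen k α' β' γ' i)
    (hf : ∀ i, f (agen k α β γ i) ∈ Submodule.span k (Set.range (agen k α' β' γ')))
    (hg : ∀ i, g (agen k α' β' γ' i) ∈ Submodule.span k (Set.range (agen k α β γ))) :
    ∃ e : SklyA k α β γ ≃ₐ[k] SklyA k α' β' γ',
      Submodule.map e.toLinearMap (Submodule.span k (Set.range (agen k α β γ))) =
        Submodule.span k (Set.range (agen k α' β' γ')) := by
  refine ⟨AlgEquiv.ofAlgHom f g (algHom_ext hfg) (algHom_ext hgf), le_antisymm ?_ ?_⟩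
  · rw [Submodule.map_span_le]
    rintro _ ⟨i, rfl⟩
    exact hf i
  · rw [Submodule.span_le]
    rintro _ ⟨i, rfl⟩
    exact ⟨_, hg i, hfg i⟩

theorem SklyA.exists_algEquiv_rotate (α β γ : k) :
    ∃ e : SklyA k α β γ ≃ₐ[k] SklyA k β γ α,
      Submodule.map e.toLinearMap (Submodule.span k (Set.range (agen k α β γ))) =
        Submodule.span k (Set.range (agen k β γ α)) := by
  have hx := satisfiesFourRel_agen α β γ
  have hy := satisfiesFourRel_agen β γ α
  obtain ⟨f, hf⟩ := SatisfiesFourRel.exists_algHom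
    (y := ![agen k β γ α 0, agen k β γ α 3, agen k β γ α 1, agen k β γ α 2])
    ⟨hy.comm₃, hy.anti₃, hy.comm₁, hy.anti₁, hy.comm₂, hy.anti₂⟩
  obtain ⟨g, hg⟩ := SatisfiesFourRel.exists_algHom
    (y := ![agen k α β γ 0, agen k α β γ 2, agen k α β γ 3, agen k α β γ 1])
    ⟨hx.comm₂, hx.anti₂, hx.comm₃, hx.anti₃, hx.comm₁, hx.anti₁⟩
  refine exists_algEquiv f g ?_ ?_ ?_ ?_ <;> intro i <;> fin_cases i <;>
    simp [hf, hg, Submodule.mem_span_of_mem]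

theorem SatisfiesFourRel.neg_swap {α β γ : k} {y : Fin 4 → B}
    (h : SatisfiesFourRel (-α) (-γ) (-β) y) :
    SatisfiesFourRel α β γ ![-y 0, y 1, y 3, y 2] := by
  obtain ⟨h₁, h₂, h₃, h₄, h₅, h₆⟩ := h
  simp only [neg_smul, smul_add] at h₁ h₃ h₅
  constructor <;> simp <;> grind

theorem SklyA.exists_algEquiv_neg_swap (α β γ : k) :
    ∃ e : SklyA k α β γ ≃ₐ[k] SklyA k (-α) (-γ) (-β),
      Submodule.map e.toLinearMap (Submodule.span k (Set.range (agen k α β γ))) =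
        Submodule.span k (Set.range (agen k (-α) (-γ) (-β))) := by
  have hx := satisfiesFourRel_agen α β γ
  have hy := satisfiesFourRel_agen (-α) (-γ) (-β)
  obtain ⟨f, hf⟩ := hy.neg_swap.exists_algHom
  obtain ⟨g, hg⟩ :=
    SatisfiesFourRel.exists_algHom (SatisfiesFourRel.neg_swap (α := -α) (β := -γ) (γ := -β)
      (y := agen k α β γ) (by simpa using hx))
  refine exists_algEquiv f g ?_ ?_ ?_ ?_ <;> intro i <;> fin_cases i <;>
    simp [hf, hg, Submodule.mem_span_of_mem]

end

/-- There are graded `k`-algebra isomorphisms `A(α,β,γ) ≅ A(β,γ,α)` and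
`A(α,β,γ) ≅ A(−α,−γ,−β)`; consequently
`A(α,β,γ) ≅ A(β,γ,α) ≅ A(γ,α,β) ≅ A(−α,−γ,−β) ≅ A(−β,−α,−γ) ≅ A(−γ,−β,−α)`. -/
theorem sklyanin4_isomorphisms (α β γ : k) :
    (∃ e : SklyA k α β γ ≃ₐ[k] SklyA k β γ α,
      Submodule.map e.toLinearMap (Submodule.span k (Set.range (agen k α β γ))) =
        Submodule.span k (Set.range (agen k β γ α))) ∧
    (∃ e : SklyA k α β γ ≃ₐ[k] SklyA k (-α) (-γ) (-β),
      Submodule.map e.toLinearMap (Submodule.span k (Set.range (agen k α β γ))) =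
        Submodule.span k (Set.range (agen k (-α) (-γ) (-β)))) ∧
    Nonempty (SklyA k α β γ ≃ₐ[k] SklyA k γ α β) ∧
    Nonempty (SklyA k α β γ ≃ₐ[k] SklyA k (-β) (-α) (-γ)) ∧
    Nonempty (SklyA k α β γ ≃ₐ[k] SklyA k (-γ) (-β) (-α)) := by
  obtain ⟨r, hr⟩ := SklyA.exists_algEquiv_rotate α β γ
  obtain ⟨r', -⟩ := SklyA.exists_algEquiv_rotate β γ α
  obtain ⟨s, hs⟩ := SklyA.exists_algEquiv_neg_swap α β γ
  obtain ⟨s', -⟩ := SklyA.exists_algEquiv_neg_swap β γ α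
  obtain ⟨s'', -⟩ := SklyA.exists_algEquiv_neg_swap γ α β
  exact ⟨⟨r, hr⟩, ⟨s, hs⟩, ⟨r.trans r'⟩, ⟨r.trans s'⟩, ⟨(r.trans r').trans s''⟩⟩
end
end
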